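/- arXiv:2512.09842 — 3 statements merged into one kernel-verified Lean document; each statement's English description precedes it below -/
import Mathlib

section
/- Measure-zero Kakeya sets in all dimensions: for every n ≥ 2 there exists a Kakeya set K ⊆ ℝⁿ with n-dimensional Lebesgue measure |K| = 0. -/
open MeasureTheory

/-- A Kakeya set in `ℝⁿ`: a compact set containing a unit line segment in every direction. -/
def IsKakeya {n : ℕ} (K : Set (EuclideanSpace ℝ (Fin n))) : Prop :=
  IsCompact K ∧
    ∀ ω : EuclideanSpace ℝ (Fin n), ‖ω‖ = 1 →
      ∃ a : EuclideanSpace ℝ (Fin n), ∀ t ∈ Set.Icc (0 : ℝ) 1, a + t • ω ∈ K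

open Filter Topology Set Pointwise

namespace Kakeya

/-- The sum of the binary expansion with digits `d`, the `i`-th digit being weighted by `w i`. -/
noncomputable def weightedDigits (w : ℕ → ℝ) (d : ℕ → Fin 2) : ℝ :=
  ∑' i, w i * Real.ofDigitsTerm d i

lemma abs_ofDigitsTerm_two_le (d : ℕ → Fin 2) (i : ℕ) :
    |Real.ofDigitsTerm d i| ≤ ((2 : ℝ) ^ (i + 1))⁻¹ := by
  rw [abs_of_nonneg Real.ofDigitsTerm_nonneg]
  refine Real.ofDigitsTerm_le.trans (le_of_eq ?_)
  norm_num

lemma abs_mul_ofDigitsTerm_two_le (w : ℕ → ℝ) (d : ℕ → Fin 2) (i : ℕ) :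
    ‖w i * Real.ofDigitsTerm d i‖ ≤ |w i| * ((2 : ℝ) ^ (i + 1))⁻¹ := by
  rw [Real.norm_eq_abs, abs_mul]
  gcongr
  exact abs_ofDigitsTerm_two_le d i

lemma summable_const_mul_two_pow_inv (C : ℝ) :
    Summable fun i : ℕ ↦ C * ((2 : ℝ) ^ (i + 1))⁻¹ := by
  refine (summable_geometric_two' C).congr fun i ↦ ?_
  rw [pow_succ]
  field_simp

variable {w : ℕ → ℝ} {C : ℝ}

lemma summable_abs_mul_two_pow_inv (hw : ∀ i, |w i| ≤ C) :
    Summable fun i : ℕ ↦ |w i| * ((2 : ℝ) ^ (i + 1))⁻¹ :=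
  (summable_const_mul_two_pow_inv C).of_nonneg_of_le (fun _ ↦ by positivity)
    fun i ↦ by gcongr; exact hw i

lemma summable_weightedDigits (hw : ∀ i, |w i| ≤ C) (d : ℕ → Fin 2) :
    Summable fun i ↦ w i * Real.ofDigitsTerm d i :=
  (summable_abs_mul_two_pow_inv hw).of_norm_bounded (abs_mul_ofDigitsTerm_two_le w d)

lemma continuous_weightedDigits (hw : ∀ i, |w i| ≤ C) : Continuous (weightedDigits w) := by
  refine continuous_tsum (fun i ↦ ?_) (summable_abs_mul_two_pow_inv hw)
    fun i d ↦ abs_mul_ofDigitsTerm_two_le w d i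
  unfold Real.ofDigitsTerm
  have : Continuous fun c : Fin 2 ↦ (c : ℝ) := continuous_of_discreteTopology
  fun_prop

lemma weightedDigits_eq_add (hw : ∀ i, |w i| ≤ C) (d : ℕ → Fin 2) :
    weightedDigits w d =
      w 0 * d 0 / 2 + (1 / 2) * weightedDigits (fun i ↦ w (i + 1)) (fun i ↦ d (i + 1)) := by
  rw [weightedDigits, (summable_weightedDigits hw d).tsum_eq_zero_add, weightedDigits,
    ← tsum_mul_left]
  congr 1
  · simp [Real.ofDigitsTerm]
    ring
  · refine tsum_congr fun i ↦ ?_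
    simp only [Real.ofDigitsTerm]
    rw [pow_succ _ (i + 1), mul_inv]
    push_cast
    ring

lemma volume_range_weightedDigits_le_succ (hw : ∀ i, |w i| ≤ C) :
    volume (range (weightedDigits w)) ≤
      volume (range (weightedDigits fun i ↦ w (i + 1))) := by
  set R := range (weightedDigits fun i ↦ w (i + 1))
  have hsub : range (weightedDigits w) ⊆
      ⋃ c : Fin 2, (w 0 * c / 2 : ℝ) +ᵥ ((1 / 2 : ℝ) • R) := by
    rintro _ ⟨d, rfl⟩
    refine mem_iUnion.2 ⟨d 0, ?_⟩
    rw [weightedDigits_eq_add hw]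
    exact vadd_mem_vadd_set (smul_mem_smul_set (mem_range_self _))
  calc volume (range (weightedDigits w))
      ≤ ∑ c : Fin 2, volume ((w 0 * c / 2 : ℝ) +ᵥ ((1 / 2 : ℝ) • R)) :=
        (measure_mono hsub).trans (measure_iUnion_fintype_le _ _)
    _ = 2 * (ENNReal.ofReal (1 / 2) * volume R) := by
        simp [measure_vadd, Measure.addHaar_smul]
    _ = volume R := by
        rw [← mul_assoc, show (2 : ENNReal) = ENNReal.ofReal 2 by simp,
          ← ENNReal.ofReal_mul (by norm_num)]
        norm_num

lemma volume_range_weightedDigits_le_shift (hw : ∀ i, |w i| ≤ C) (m : ℕ) :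
    volume (range (weightedDigits w)) ≤
      volume (range (weightedDigits fun i ↦ w (m + i))) := by
  induction m with
  | zero => simp
  | succ m ih =>
    refine ih.trans ((volume_range_weightedDigits_le_succ fun i ↦ hw (m + i)).trans_eq ?_)
    simp only [add_assoc, add_comm 1]

lemma volume_range_weightedDigits_le (hw : ∀ i, |w i| ≤ C) :
    volume (range (weightedDigits w)) ≤
      ENNReal.ofReal (2 * ∑' i, |w i| * ((2 : ℝ) ^ (i + 1))⁻¹) := by
  rw [← Real.volume_closedBall 0]
  refine measure_mono ?_
  rintro _ ⟨d, rfl⟩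
  rw [mem_closedBall_zero_iff]
  exact tsum_of_norm_bounded (summable_abs_mul_two_pow_inv hw).hasSum
    (abs_mul_ofDigitsTerm_two_le w d)

lemma volume_range_weightedDigits_eq_zero (hw : ∀ i, |w i| ≤ C) {m : ℕ → ℕ}
    (hm : ∀ i, Tendsto (fun k ↦ w (m k + i)) atTop (𝓝 0)) :
    volume (range (weightedDigits w)) = 0 := by
  have hlim : Tendsto (fun k ↦ ∑' i, |w (m k + i)| * ((2 : ℝ) ^ (i + 1))⁻¹) atTop
      (𝓝 (∑' _ : ℕ, (0 : ℝ))) := by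
    refine tendsto_tsum_of_dominated_convergence (summable_const_mul_two_pow_inv C)
      (fun i ↦ ?_) (.of_forall fun k i ↦ ?_)
    · simpa using (hm i).abs.mul_const ((2 : ℝ) ^ (i + 1))⁻¹
    · rw [Real.norm_of_nonneg (by positivity)]
      gcongr
      exact hw _
  rw [tsum_zero] at hlim
  have hlim' := ENNReal.tendsto_ofReal (hlim.const_mul 2)
  rw [mul_zero, ENNReal.ofReal_zero] at hlim'
  refine le_antisymm (ge_of_tendsto' hlim' fun k ↦ ?_) zero_le
  exact (volume_range_weightedDigits_le_shift hw (m k)).trans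
    (volume_range_weightedDigits_le fun i ↦ hw (m k + i))

/-- In a separable first countable space there is a sequence containing, for every point, arbitrarily
long runs of terms arbitrarily close to that point. -/
lemma exists_seq_forall_exists_shift_tendsto (X : Type*) [TopologicalSpace X]
    [FirstCountableTopology X] [TopologicalSpace.SeparableSpace X] [Nonempty X] :
    ∃ u : ℕ → X, ∀ x, ∃ m : ℕ → ℕ, ∀ i, Tendsto (fun k ↦ u (m k + i)) atTop (𝓝 x) := by
  let q := TopologicalSpace.denseSeq X
  refine ⟨fun i ↦ q (Nat.unpair (Nat.log 2 i)).1, fun x ↦ ?_⟩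
  obtain ⟨v, hv, hvx⟩ := mem_closure_iff_seq_limit.1
    (TopologicalSpace.denseRange_denseSeq X x)
  choose n hn using hv
  refine ⟨fun k ↦ 2 ^ Nat.pair (n k) k, fun i ↦ hvx.congr' ?_⟩
  filter_upwards [eventually_ge_atTop i] with k hk
  have hlt : i < 2 ^ Nat.pair (n k) k :=
    (hk.trans (Nat.right_le_pair _ _)).trans_lt Nat.lt_two_pow_self
  have hlog : Nat.log 2 (2 ^ Nat.pair (n k) k + i) = Nat.pair (n k) k :=
    Nat.log_eq_of_pow_le_of_lt_pow (Nat.le_add_right _ _) (by rw [pow_succ]; omega)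
  simp only [hlog, Nat.unpair_pair]
  exact (hn k).symm

/-- A compact null set in the plane containing, for every slope in `[0, 1]`, a segment of that slope
lying over `[-1, 1]`. -/
lemma exists_isCompact_volume_eq_zero_segments :
    ∃ K : Set (ℝ × ℝ), IsCompact K ∧ volume K = 0 ∧
      ∀ s ∈ Icc (0 : ℝ) 1, ∃ y : ℝ, ∀ t ∈ Icc (-1 : ℝ) 1, (t, y + t * s) ∈ K := by
  have : Nonempty (Icc (-1 : ℝ) 1) := ⟨0, by norm_num⟩
  obtain ⟨u, hu⟩ := exists_seq_forall_exists_shift_tendsto (Icc (-1 : ℝ) 1)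
  let v : ℕ → ℝ := fun i ↦ -(u i : ℝ)
  have hv : ∀ i, |v i| ≤ 1 := fun i ↦ by simpa [v] using abs_le.2 (u i).2
  have hcont : Continuous fun p : ℝ × (ℕ → Fin 2) ↦
      (p.1, weightedDigits v p.2 + p.1 * Real.ofDigits p.2) :=
    continuous_fst.prodMk (((continuous_weightedDigits hv).comp continuous_snd).add
      (continuous_fst.mul (Real.continuous_ofDigits.comp continuous_snd)))
  have hK := ((isCompact_Icc (a := (-1 : ℝ)) (b := 1)).prod
    (isCompact_univ (X := ℕ → Fin 2))).image hcont
  refine ⟨_, hK, ?_, fun s hs ↦ ?_⟩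
  · refine Measure.measure_prod_null_of_ae_null hK.measurableSet (.of_forall fun t ↦ ?_)
    by_cases ht : t ∈ Icc (-1 : ℝ) 1
    · obtain ⟨m, hm⟩ := hu ⟨t, ht⟩
      have hw : ∀ i, |t + v i| ≤ 2 := fun i ↦
        (abs_add_le _ _).trans (by linarith [hv i, abs_le.2 ht])
      refine measure_mono_null ?_ (volume_range_weightedDigits_eq_zero hw (m := m) fun i ↦ ?_)
      · rintro y ⟨⟨t', d⟩, -, h⟩
        obtain ⟨rfl, rfl⟩ := Prod.mk.inj h
        refine ⟨d, ?_⟩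
        simp only [weightedDigits, Real.ofDigits]
        rw [← tsum_mul_left, ← (summable_weightedDigits hv d).tsum_add
          (Real.summable_ofDigitsTerm.mul_left _)]
        exact tsum_congr fun i ↦ by ring
      · have := ((continuous_subtype_val.tendsto _).comp (hm i)).const_sub t
        simpa [v, Function.comp_def, sub_eq_add_neg] using this
    · refine measure_mono_null (t := ∅) ?_ measure_empty
      rintro y ⟨⟨t', d⟩, ⟨ht', -⟩, h⟩
      obtain ⟨rfl, -⟩ := Prod.mk.inj h
      exact ht ht'
  · obtain ⟨d, -, rfl⟩ := Real.ofDigits_SurjOn one_lt_two hs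
    exact ⟨weightedDigits v d, fun t ht ↦ ⟨(t, d), ⟨ht, mem_univ _⟩, rfl⟩⟩

/-- The linear map sending the direction `(a, b)` in the coordinates `i`, `j` to a direction in the
plane whose slope lies in `[0, 1]` when `|b| ≤ |a|`. -/
noncomputable def shearedProj {n : ℕ} (i j : Fin n) : EuclideanSpace ℝ (Fin n) →L[ℝ] ℝ × ℝ :=
  (EuclideanSpace.proj i).prod
    ((1 / 2 : ℝ) • (EuclideanSpace.proj i + EuclideanSpace.proj j))

lemma shearedProj_apply {n : ℕ} (i j : Fin n) (x : EuclideanSpace ℝ (Fin n)) :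
    shearedProj i j x = (x i, (x i + x j) / 2) := by
  simp [shearedProj]
  ring

lemma shearedProj_surjective {n : ℕ} {i j : Fin n} (hij : i ≠ j) :
    Function.Surjective (shearedProj i j) := by
  rintro ⟨a, b⟩
  refine ⟨EuclideanSpace.single i a + EuclideanSpace.single j (2 * b - a), ?_⟩
  simp [shearedProj_apply, hij, hij.symm]

/-- A compact null set containing a unit segment in every direction `ω` with `|ω j| ≤ |ω i|`. -/
lemma exists_isCompact_volume_eq_zero_of_ne {n : ℕ} {i j : Fin n} (hij : i ≠ j) :
    ∃ K : Set (EuclideanSpace ℝ (Fin n)), IsCompact K ∧ volume K = 0 ∧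
      ∀ ω : EuclideanSpace ℝ (Fin n), ‖ω‖ = 1 → |ω j| ≤ |ω i| →
        ∃ a, ∀ t ∈ Icc (0 : ℝ) 1, a + t • ω ∈ K := by
  obtain ⟨K, hK, hK0, hseg⟩ := exists_isCompact_volume_eq_zero_segments
  obtain ⟨R, hR⟩ := hK.isBounded.exists_norm_le
  refine ⟨shearedProj i j ⁻¹' K ∩ Metric.closedBall 0 (2 * R + 1),
    (isCompact_closedBall _ _).inter_left (hK.isClosed.preimage (shearedProj i j).continuous),
    measure_mono_null inter_subset_left ?_, fun ω hω hle ↦ ?_⟩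
  · have := (ae_comp_linearMap_mem_iff (shearedProj i j).toLinearMap volume volume
      (shearedProj_surjective hij) hK.measurableSet.compl).2 (measure_eq_zero_iff_ae_notMem.1 hK0)
    exact measure_eq_zero_iff_ae_notMem.2 this
  · obtain ⟨s, hs, hsω⟩ : ∃ s ∈ Icc (0 : ℝ) 1, (ω i + ω j) / 2 = ω i * s := by
      by_cases h0 : ω i = 0
      · have : ω j = 0 := by simpa [h0] using hle
        exact ⟨0, by simp, by simp [h0, this]⟩
      · have hdiv : |ω j / ω i| ≤ 1 := by
          rw [abs_div]
          exact div_le_one_of_le₀ hle (abs_nonneg _)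
        have := abs_le.1 hdiv
        refine ⟨(1 + ω j / ω i) / 2, ⟨by linarith, by linarith⟩, ?_⟩
        field_simp
    obtain ⟨y, hy⟩ := hseg s hs
    have hyR : |y| ≤ R := by
      have := (norm_snd_le _).trans (hR _ (hy 0 (by norm_num)))
      simpa using this
    have hωi : |ω i| ≤ 1 := hω ▸ PiLp.norm_apply_le ω i
    refine ⟨EuclideanSpace.single j (2 * y), fun t ht ↦ ⟨?_, ?_⟩⟩
    · have htω : |t * ω i| ≤ 1 := by
        rw [abs_mul, abs_of_nonneg ht.1]
        exact mul_le_one₀ ht.2 (abs_nonneg _) hωi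
      have hmem := hy (t * ω i) (abs_le.1 htω)
      rw [mul_assoc, ← hsω] at hmem
      rw [mem_preimage, shearedProj_apply]
      convert hmem using 2
      · simp [hij]
      · simp [hij]
        ring
    · rw [mem_closedBall_zero_iff]
      refine (norm_add_le _ _).trans ?_
      rw [norm_smul, hω, mul_one, PiLp.norm_single, norm_mul]
      simp only [Real.norm_eq_abs, abs_two, abs_of_nonneg ht.1]
      linarith [ht.2]

end Kakeya

/-- **Measure-zero Kakeya sets in all dimensions**: for every `n ≥ 2` there exists a Kakeya
set `K ⊆ ℝⁿ` with `|K| = 0`. -/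
theorem kakeya_measure_zero_all_dimensions (n : ℕ) (hn : 2 ≤ n) :
    ∃ K : Set (EuclideanSpace ℝ (Fin n)), IsKakeya K ∧ volume K = 0 := by
  have : Nontrivial (Fin n) := Fin.nontrivial_iff_two_le.2 hn
  obtain ⟨i, j, hij⟩ := exists_pair_ne (Fin n)
  obtain ⟨K₁, hK₁, h₁, hseg₁⟩ := Kakeya.exists_isCompact_volume_eq_zero_of_ne hij
  obtain ⟨K₂, hK₂, h₂, hseg₂⟩ := Kakeya.exists_isCompact_volume_eq_zero_of_ne hij.symm
  refine ⟨K₁ ∪ K₂, ⟨hK₁.union hK₂, fun ω hω ↦ ?_⟩, measure_union_null h₁ h₂⟩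
  rcases le_total |ω j| |ω i| with h | h
  · obtain ⟨a, ha⟩ := hseg₁ ω hω h
    exact ⟨a, fun t ht ↦ Or.inl (ha t ht)⟩
  · obtain ⟨a, ha⟩ := hseg₂ ω hω h
    exact ⟨a, fun t ht ↦ Or.inr (ha t ht)⟩
end

section
/- Davies's theorem (planar Kakeya): every Kakeya set K ⊆ ℝ² has Hausdorff dimension 2. -/
open MeasureTheory

/-- Covers witnessing that a Hausdorff measure vanishes, with dyadic bounds on the diameters. -/
theorem exists_dyadic_cover {X : Type*} [MetricSpace X] [MeasurableSpace X] [BorelSpace X]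
    {K : Set X} {s ε : ℝ} (hs : 0 < s) (hε : 0 < ε) (hK : μH[s] K = 0) :
    ∃ (t : ℕ → Set X) (k : ℕ → ℕ), K ⊆ ⋃ n, t n ∧
      (∀ n, ∀ x ∈ t n, ∀ y ∈ t n, dist x y ≤ (1 / 2 : ℝ) ^ k n) ∧
      ∀ F : Finset ℕ, ∑ n ∈ F, ((1 / 2 : ℝ) ^ s) ^ k n ≤ ε := by
  have h2s : 0 < (2 : ℝ) ^ s := by positivity
  have hp0 : 0 < (1 / 2 : ℝ) ^ s := by positivity
  have hp1 : (1 / 2 : ℝ) ^ s < 1 := Real.rpow_lt_one (by norm_num) (by norm_num) hs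
  have hinf : (⨅ (t : ℕ → Set X) (_ : K ⊆ ⋃ n, t n) (_ : ∀ n, Metric.ediam (t n) ≤ 1),
      ∑' n, ⨆ _ : (t n).Nonempty, Metric.ediam (t n) ^ s) < ENNReal.ofReal (ε / 2 / 2 ^ s) := by
    refine lt_of_le_of_lt ?_ (ENNReal.ofReal_pos.2 (show 0 < ε / 2 / 2 ^ s by positivity))
    rw [← hK, Measure.hausdorffMeasure_apply]
    exact le_iSup₂_of_le (1 : ENNReal) one_pos le_rfl
  simp only [iInf_lt_iff] at hinf
  obtain ⟨t, hcov, hdiam, hsum⟩ := hinf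
  obtain ⟨η, hη0, hη⟩ := ENNReal.exists_pos_sum_of_countable'
    (ENNReal.ofReal_pos.2 (half_pos hε)).ne' ℕ
  have key : ∀ n, ∃ k : ℕ, Metric.ediam (t n) ≤ ENNReal.ofReal ((1 / 2 : ℝ) ^ k) ∧
      ENNReal.ofReal (((1 / 2 : ℝ) ^ s) ^ k) ≤
        ENNReal.ofReal (2 ^ s) * (⨆ _ : (t n).Nonempty, Metric.ediam (t n) ^ s) + η n := by
    intro n
    by_cases hD : Metric.ediam (t n) = 0
    · have : Filter.Tendsto (fun k : ℕ ↦ ENNReal.ofReal (((1 / 2 : ℝ) ^ s) ^ k)) Filter.atTop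
          (nhds 0) := by
        simpa using ENNReal.tendsto_ofReal (tendsto_pow_atTop_nhds_zero_of_lt_one hp0.le hp1)
      obtain ⟨k, hk⟩ := (this.eventually (gt_mem_nhds (hη0 n))).exists
      exact ⟨k, by simp [hD], hk.le.trans le_add_self⟩
    · have hne : (t n).Nonempty := by
        by_contra h
        simp [Set.not_nonempty_iff_eq_empty.1 h] at hD
      have htop : Metric.ediam (t n) ≠ ⊤ := ((hdiam n).trans_lt ENNReal.one_lt_top).ne
      obtain ⟨d, hd⟩ : ∃ d : ℝ, d = (Metric.ediam (t n)).toReal := ⟨_, rfl⟩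
      have hd0 : 0 < d := hd ▸ ENNReal.toReal_pos hD htop
      have hdE : Metric.ediam (t n) = ENNReal.ofReal d := by rw [hd, ENNReal.ofReal_toReal htop]
      have hd1 : d ≤ 1 := by
        have := hdiam n
        rwa [hdE, ENNReal.ofReal_le_one] at this
      obtain ⟨k, hk1, hk2⟩ := exists_nat_pow_near_of_lt_one hd0 hd1
        (by norm_num : (0 : ℝ) < 1 / 2) (by norm_num)
      refine ⟨k, hdE ▸ ENNReal.ofReal_le_ofReal hk2, le_add_right ?_⟩
      rw [ciSup_pos hne, hdE, ENNReal.ofReal_rpow_of_pos hd0, ← ENNReal.ofReal_mul h2s.le]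
      apply ENNReal.ofReal_le_ofReal
      rw [← Real.mul_rpow (by norm_num) hd0.le, Real.rpow_pow_comm (by norm_num)]
      apply Real.rpow_le_rpow (by positivity) _ hs.le
      rw [pow_succ] at hk1
      linarith
  choose k hk1 hk2 using key
  refine ⟨t, k, hcov, fun n x hx y hy ↦ ?_, fun F ↦ ?_⟩
  · have := (Metric.edist_le_ediam_of_mem hx hy).trans (hk1 n)
    rwa [edist_dist, ENNReal.ofReal_le_ofReal_iff (by positivity)] at this
  · rw [← ENNReal.ofReal_le_ofReal_iff hε.le, ENNReal.ofReal_sum_of_nonneg (by intros; positivity)]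
    calc _ ≤ ∑ n ∈ F, (ENNReal.ofReal (2 ^ s) *
          (⨆ _ : (t n).Nonempty, Metric.ediam (t n) ^ s) + η n) := Finset.sum_le_sum fun n _ ↦ hk2 n
      _ ≤ ∑' n, (ENNReal.ofReal (2 ^ s) *
          (⨆ _ : (t n).Nonempty, Metric.ediam (t n) ^ s) + η n) := ENNReal.sum_le_tsum F
      _ = ENNReal.ofReal (2 ^ s) * (∑' n, ⨆ _ : (t n).Nonempty, Metric.ediam (t n) ^ s) +
          ∑' n, η n := by rw [ENNReal.tsum_add, ENNReal.tsum_mul_left]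
      _ ≤ ENNReal.ofReal (2 ^ s) * ENNReal.ofReal (ε / 2 / 2 ^ s) + ENNReal.ofReal (ε / 2) := by
          gcongr
      _ = ENNReal.ofReal ε := by
          rw [← ENNReal.ofReal_mul h2s.le, ← ENNReal.ofReal_add (by positivity) (by positivity)]
          congr 1
          field_simp
          ring

/-- The index of the dyadic square of side `2⁻ᵏ` containing `(x, y)`. -/
noncomputable def dyadicCell (k : ℕ) (x y : ℝ) : ℤ × ℤ := (⌊x * 2 ^ k⌋, ⌊y * 2 ^ k⌋)

theorem floor_mem_Icc_of_abs_sub_le {x y : ℝ} (h : |x - y| ≤ 1) :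
    ⌊x⌋ ∈ Finset.Icc (⌊y⌋ - 1) (⌊y⌋ + 1) := by
  rw [abs_le] at h
  rw [Finset.mem_Icc]
  constructor
  · rw [Int.le_floor]
    push_cast
    linarith [Int.floor_le y]
  · rw [← Int.lt_add_one_iff, Int.floor_lt]
    push_cast
    linarith [Int.lt_floor_add_one y]

theorem exists_dyadicCell_cover {K : Set (EuclideanSpace ℝ (Fin 2))} {s ε : ℝ} (hs : 0 < s)
    (hε : 0 < ε) (hK : μH[s] K = 0) :
    ∃ Q : ℕ → Finset (ℤ × ℤ), (∀ p ∈ K, ∃ k, dyadicCell k (p 0) (p 1) ∈ Q k) ∧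
      ∀ k, ((Q k).card : ℝ) * ((1 / 2 : ℝ) ^ s) ^ k ≤ 9 * ε := by
  classical
  obtain ⟨t, κ, hcov, hdist, hsum⟩ := exists_dyadic_cover hs hε hK
  have hp0 : 0 < (1 / 2 : ℝ) ^ s := by positivity
  have hcard : ∀ k, ∀ F : Finset ℕ, ↑F ⊆ {n | κ n = k} →
      (F.card : ℝ) * ((1 / 2 : ℝ) ^ s) ^ k ≤ ε := by
    intro k F hF
    refine le_trans (le_of_eq ?_) (hsum F)
    rw [Finset.sum_congr rfl fun n hn ↦ by rw [show κ n = k from hF hn], Finset.sum_const,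
      nsmul_eq_mul]
  have hfin : ∀ k, {n | κ n = k}.Finite := by
    intro k
    by_contra hinf
    obtain ⟨N, hN⟩ := exists_nat_gt (ε / ((1 / 2 : ℝ) ^ s) ^ k)
    obtain ⟨F, hF, rfl⟩ := Set.Infinite.exists_subset_card_eq hinf N
    rw [div_lt_iff₀ (by positivity)] at hN
    exact absurd (hcard k F hF) (not_le.2 hN)
  have hblock : ∀ n, ∃ B : Finset (ℤ × ℤ), B.card ≤ 9 ∧
      ∀ p ∈ t n, dyadicCell (κ n) (p 0) (p 1) ∈ B := by
    intro n
    rcases (t n).eq_empty_or_nonempty with h | ⟨o, ho⟩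
    · exact ⟨∅, by simp [h]⟩
    · refine ⟨Finset.Icc (⌊o 0 * 2 ^ κ n⌋ - 1) (⌊o 0 * 2 ^ κ n⌋ + 1) ×ˢ
        Finset.Icc (⌊o 1 * 2 ^ κ n⌋ - 1) (⌊o 1 * 2 ^ κ n⌋ + 1), ?_, fun p hp ↦ ?_⟩
      · have h3 : ∀ z : ℤ, (Finset.Icc (z - 1) (z + 1)).card = 3 := by
          intro z
          rw [Int.card_Icc]
          omega
        rw [Finset.card_product, h3, h3]
      · have hcoord : ∀ i, |p i * 2 ^ κ n - o i * 2 ^ κ n| ≤ 1 := by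
          intro i
          have h1 : |p i - o i| ≤ (1 / 2 : ℝ) ^ κ n := by
            have := PiLp.norm_apply_le (p - o) i
            rw [← dist_eq_norm] at this
            exact this.trans (hdist n p hp o ho)
          rw [← sub_mul, abs_mul, abs_of_pos (by positivity : (0 : ℝ) < 2 ^ κ n)]
          calc _ ≤ (1 / 2 : ℝ) ^ κ n * 2 ^ κ n := by gcongr
            _ = 1 := by rw [← mul_pow]; norm_num
        exact Finset.mem_product.2
          ⟨floor_mem_Icc_of_abs_sub_le (hcoord 0), floor_mem_Icc_of_abs_sub_le (hcoord 1)⟩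
  choose B hB9 hB using hblock
  refine ⟨fun k ↦ (hfin k).toFinset.biUnion B, fun p hp ↦ ?_, fun k ↦ ?_⟩
  · obtain ⟨n, hn⟩ := Set.mem_iUnion.1 (hcov hp)
    exact ⟨κ n, Finset.mem_biUnion.2 ⟨n, by simp, hB n p hn⟩⟩
  · have h1 : (((hfin k).toFinset.biUnion B).card : ℝ) ≤ (hfin k).toFinset.card * 9 := by
      exact_mod_cast Finset.card_biUnion_le_card_mul _ _ _ fun n _ ↦ hB9 n
    have h2 := hcard k (hfin k).toFinset (by simp)
    calc _ ≤ ((hfin k).toFinset.card * 9 : ℝ) * ((1 / 2 : ℝ) ^ s) ^ k := by gcongr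
      _ ≤ 9 * ε := by linarith

theorem exists_segment_of_slope {K : Set (EuclideanSpace ℝ (Fin 2))}
    (hK : ∀ ω : EuclideanSpace ℝ (Fin 2), ‖ω‖ = 1 →
      ∃ a : EuclideanSpace ℝ (Fin 2), ∀ t ∈ Set.Icc (0 : ℝ) 1, a + t • ω ∈ K)
    {m : ℝ} (hm : m ∈ Set.Icc (0 : ℝ) 1) :
    ∃ x₀ c : ℝ, ∀ x ∈ Set.Icc x₀ (x₀ + 1 / 2), !₂[x, m * x + c] ∈ K := by
  have hr : 0 < √(1 + m ^ 2) := by positivity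
  have hr2 : √(1 + m ^ 2) ≤ 2 := by
    rw [Real.sqrt_le_left (by norm_num)]
    nlinarith [hm.1, hm.2]
  obtain ⟨a, ha⟩ := hK ((√(1 + m ^ 2))⁻¹ • !₂[1, m]) (by
    rw [norm_smul, EuclideanSpace.norm_eq]
    simp [abs_of_pos hr, hr.ne'])
  refine ⟨a 0, a 1 - m * a 0, fun x hx ↦ ?_⟩
  convert ha ((x - a 0) * √(1 + m ^ 2)) ⟨mul_nonneg (by linarith [hx.1]) hr.le, ?_⟩ using 1
  · ext i
    fin_cases i <;> simp <;> field_simp <;> ring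
  · nlinarith [hx.1, hx.2]

theorem card_le_of_abs_sub_lt_one {A : Finset (ℤ × ℤ)} {L : ℤ → ℝ} {u v : ℝ} (huv : u ≤ v)
    (hu : ∀ q ∈ A, u ≤ q.1) (hv : ∀ q ∈ A, q.1 ≤ v) (hL : ∀ q ∈ A, |(q.2 : ℝ) - L q.1| < 1) :
    (A.card : ℝ) ≤ 2 * (v - u + 1) := by
  classical
  have hsub : A ⊆ (Finset.Icc ⌈u⌉ ⌊v⌋ ×ˢ ({0, 1} : Finset ℤ)).image
      fun p ↦ (p.1, ⌊L p.1⌋ + p.2) := by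
    intro q hq
    have h := abs_lt.1 (hL q hq)
    have h1 : ⌊L q.1⌋ < q.2 + 1 := by
      rw [Int.floor_lt]
      push_cast
      linarith
    have h2 : q.2 < ⌊L q.1⌋ + 2 := by
      have := Int.lt_floor_add_one (L q.1)
      have h3 : (q.2 : ℝ) < (⌊L q.1⌋ + 2 : ℤ) := by
        push_cast
        linarith
      exact_mod_cast h3
    refine Finset.mem_image.2 ⟨(q.1, q.2 - ⌊L q.1⌋), ?_, by simp⟩
    simp only [Finset.mem_product, Finset.mem_Icc, Finset.mem_insert, Finset.mem_singleton]
    refine ⟨⟨Int.ceil_le.2 (hu q hq), Int.le_floor.2 (hv q hq)⟩, ?_⟩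
    omega
  have hIcc : ((Finset.Icc ⌈u⌉ ⌊v⌋).card : ℝ) ≤ v - u + 1 := by
    have h1 : (0 : ℝ) ≤ v - u + 1 := by linarith
    have h2 : ((⌊v⌋ + 1 - ⌈u⌉ : ℤ) : ℝ) ≤ v - u + 1 := by
      push_cast
      linarith [Int.floor_le v, Int.le_ceil u]
    rw [Int.card_Icc, ← Int.cast_natCast, Int.toNat_eq_max, Int.cast_max]
    exact max_le h2 (by simpa using h1)
  have hc := (Finset.card_le_card hsub).trans Finset.card_image_le
  rw [Finset.card_product, Finset.card_pair (by norm_num)] at hc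
  have : (A.card : ℝ) ≤ (Finset.Icc ⌈u⌉ ⌊v⌋).card * 2 := by exact_mod_cast hc
  linarith

theorem card_le_of_transversal {A : Finset (ℤ × ℤ)} {m m' c c' : ℝ} (hm : m ≠ m')
    (h : ∀ q ∈ A, |(q.2 : ℝ) - (m * q.1 + c)| < 1)
    (h' : ∀ q ∈ A, |(q.2 : ℝ) - (m' * q.1 + c')| < 1) :
    (A.card : ℝ) ≤ 2 * (4 / |m - m'| + 1) := by
  have hd : 0 < |m - m'| := abs_pos.2 (sub_ne_zero.2 hm)
  have key : ∀ q ∈ A, |(q.1 : ℝ) - (c' - c) / (m - m')| ≤ 2 / |m - m'| := by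
    intro q hq
    rw [le_div_iff₀ hd, ← abs_mul, sub_mul, div_mul_cancel₀ _ (sub_ne_zero.2 hm)]
    have h1 := abs_lt.1 (h q hq)
    have h2 := abs_lt.1 (h' q hq)
    rw [abs_le]
    constructor <;> linarith
  have hpos : 0 < 2 / |m - m'| := by positivity
  have := card_le_of_abs_sub_lt_one (A := A) (L := fun a ↦ m * a + c)
    (u := (c' - c) / (m - m') - 2 / |m - m'|) (v := (c' - c) / (m - m') + 2 / |m - m'|)
    (by linarith) (fun q hq ↦ by linarith [abs_le.1 (key q hq)])
    (fun q hq ↦ by linarith [abs_le.1 (key q hq)]) h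
  refine this.trans (le_of_eq ?_)
  ring

/-- The cells of `Q` of side `2⁻ᵏ` met by the line `y = m x + c` over `[x₀, x₀ + 1/2]`. -/
noncomputable def cellsOnLine (k : ℕ) (Q : Finset (ℤ × ℤ)) (m c x₀ : ℝ) : Finset (ℤ × ℤ) :=
  open Classical in
  {q ∈ Q | ∃ x ∈ Set.Icc x₀ (x₀ + 1 / 2), dyadicCell k x (m * x + c) = q}

theorem mem_cellsOnLine {k : ℕ} {Q : Finset (ℤ × ℤ)} {m c x₀ : ℝ} {q : ℤ × ℤ} :
    q ∈ cellsOnLine k Q m c x₀ ↔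
      q ∈ Q ∧ ∃ x ∈ Set.Icc x₀ (x₀ + 1 / 2), dyadicCell k x (m * x + c) = q := by
  classical
  simp [cellsOnLine]

theorem abs_sub_lt_one_of_mem_cellsOnLine {k : ℕ} {Q : Finset (ℤ × ℤ)} {m c x₀ : ℝ}
    (hm : m ∈ Set.Icc (0 : ℝ) 1) {q : ℤ × ℤ} (hq : q ∈ cellsOnLine k Q m c x₀) :
    |(q.2 : ℝ) - (m * q.1 + c * 2 ^ k)| < 1 := by
  obtain ⟨-, x, -, rfl⟩ := mem_cellsOnLine.1 hq
  simp only [dyadicCell]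
  have h1 := Int.floor_le (x * 2 ^ k)
  have h2 := Int.lt_floor_add_one (x * 2 ^ k)
  have h3 := Int.floor_le ((m * x + c) * 2 ^ k)
  have h4 := Int.lt_floor_add_one ((m * x + c) * 2 ^ k)
  have h5 := mul_le_mul_of_nonneg_left h1 hm.1
  have h6 : m * (x * 2 ^ k - ⌊x * 2 ^ k⌋) < 1 := by
    nlinarith [hm.1, hm.2]
  rw [abs_lt]
  constructor <;> linarith

theorem card_cellsOnLine_le {k : ℕ} {Q : Finset (ℤ × ℤ)} {m c x₀ : ℝ}
    (hm : m ∈ Set.Icc (0 : ℝ) 1) : ((cellsOnLine k Q m c x₀).card : ℝ) ≤ 5 * 2 ^ k := by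
  have h2k : (1 : ℝ) ≤ 2 ^ k := one_le_pow₀ (by norm_num)
  have := card_le_of_abs_sub_lt_one (A := cellsOnLine k Q m c x₀)
    (L := fun a ↦ m * a + c * 2 ^ k) (u := x₀ * 2 ^ k - 1) (v := (x₀ + 1 / 2) * 2 ^ k)
    (by linarith) (fun q hq ↦ ?_) (fun q hq ↦ ?_)
    (fun q hq ↦ abs_sub_lt_one_of_mem_cellsOnLine hm hq)
  · linarith
  all_goals
    obtain ⟨-, x, hx, rfl⟩ := mem_cellsOnLine.1 hq
    simp only [dyadicCell]
  · have h3 : x₀ * 2 ^ k ≤ x * 2 ^ k := by gcongr; exact hx.1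
    linarith [Int.lt_floor_add_one (x * 2 ^ k)]
  · have h3 : x * 2 ^ k ≤ (x₀ + 1 / 2) * 2 ^ k := by gcongr; exact hx.2
    linarith [Int.floor_le (x * 2 ^ k)]

theorem volume_le_card_cellsOnLine (k : ℕ) (Q : Finset (ℤ × ℤ)) (m c x₀ : ℝ) :
    volume {x | x ∈ Set.Icc x₀ (x₀ + 1 / 2) ∧ dyadicCell k x (m * x + c) ∈ Q} ≤
      ENNReal.ofReal ((cellsOnLine k Q m c x₀).card / 2 ^ k) := by
  have h2k : (0 : ℝ) < 2 ^ k := by positivity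
  calc _ ≤ volume (⋃ q ∈ cellsOnLine k Q m c x₀,
        Set.Ico ((q.1 : ℝ) / 2 ^ k) ((q.1 + 1) / 2 ^ k)) := by
        apply measure_mono
        rintro x ⟨hx, hxQ⟩
        simp only [Set.mem_iUnion]
        refine ⟨_, mem_cellsOnLine.2 ⟨hxQ, x, hx, rfl⟩, ?_⟩
        rw [Set.mem_Ico, div_le_iff₀ h2k, lt_div_iff₀ h2k]
        exact ⟨Int.floor_le _, Int.lt_floor_add_one _⟩
    _ ≤ ∑ q ∈ cellsOnLine k Q m c x₀,
        volume (Set.Ico ((q.1 : ℝ) / 2 ^ k) ((q.1 + 1) / 2 ^ k)) := measure_biUnion_finset_le _ _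
    _ = ∑ q ∈ cellsOnLine k Q m c x₀, ENNReal.ofReal (1 / 2 ^ k) := by
        refine Finset.sum_congr rfl fun q _ ↦ ?_
        rw [Real.volume_Ico]
        congr 1
        ring
    _ = _ := by
        rw [Finset.sum_const, nsmul_eq_mul, ← ENNReal.ofReal_natCast,
          ← ENNReal.ofReal_mul (by positivity)]
        congr 1
        ring

theorem sq_sum_card_le_card_mul_sum_card_inter {ι β : Type*} [DecidableEq β] (I : Finset ι)
    (Q : Finset β) (A : ι → Finset β) (hA : ∀ i ∈ I, A i ⊆ Q) :
    (∑ i ∈ I, ((A i).card : ℝ)) ^ 2 ≤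
      Q.card * ∑ i ∈ I, ∑ j ∈ I, ((A i ∩ A j).card : ℝ) := by
  have h1 : ∀ B ⊆ Q, (B.card : ℝ) = ∑ q ∈ Q, if q ∈ B then 1 else 0 := by
    intro B hB
    rw [Finset.sum_boole, Finset.filter_mem_eq_inter, Finset.inter_eq_right.2 hB]
  have h2 : ∑ i ∈ I, ((A i).card : ℝ) = ∑ q ∈ Q, ∑ i ∈ I, if q ∈ A i then 1 else 0 := by
    rw [Finset.sum_comm]
    exact Finset.sum_congr rfl fun i hi ↦ h1 _ (hA i hi)
  have h3 : ∑ i ∈ I, ∑ j ∈ I, ((A i ∩ A j).card : ℝ) =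
      ∑ q ∈ Q, (∑ i ∈ I, if q ∈ A i then (1 : ℝ) else 0) ^ 2 := by
    simp_rw [sq, Finset.sum_mul_sum]
    rw [Finset.sum_comm (s := Q)]
    refine Finset.sum_congr rfl fun i hi ↦ ?_
    rw [Finset.sum_comm]
    refine Finset.sum_congr rfl fun j _ ↦ ?_
    rw [h1 _ (Finset.inter_subset_left.trans (hA i hi))]
    refine Finset.sum_congr rfl fun q _ ↦ ?_
    by_cases hi : q ∈ A i <;> by_cases hj : q ∈ A j <;> simp [hi, hj]
  rw [h2, h3]
  exact sq_sum_le_card_mul_sum_sq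

theorem sum_inv_succ_le (k : ℕ) {J : Finset ℕ} (hJ : J ⊆ Finset.range (2 ^ k)) :
    ∑ j ∈ J, ((j : ℝ) + 1)⁻¹ ≤ k + 1 := by
  calc ∑ j ∈ J, ((j : ℝ) + 1)⁻¹ ≤ ∑ j ∈ Finset.range (2 ^ k), ((j : ℝ) + 1)⁻¹ :=
        Finset.sum_le_sum_of_subset_of_nonneg hJ fun _ _ _ ↦ by positivity
    _ = (harmonic (2 ^ k) : ℝ) := by simp [harmonic]
    _ ≤ 1 + Real.log (2 ^ k : ℕ) := harmonic_le_one_add_log _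
    _ ≤ k + 1 := by
        have h2 : Real.log 2 ≤ 1 := by linarith [Real.log_two_lt_d9]
        push_cast
        rw [Real.log_pow]
        nlinarith [(Nat.cast_nonneg k : (0 : ℝ) ≤ k)]

theorem sum_inv_abs_sub_le {k i : ℕ} {I : Finset ℕ} (hI : I ⊆ Finset.range (2 ^ k))
    (hi : i ∈ I) : ∑ j ∈ I, (|(i : ℝ) - j| + 1)⁻¹ ≤ 2 * (k + 1) := by
  have hi' := Finset.mem_range.1 (hI hi)
  rw [← Finset.sum_filter_add_sum_filter_not I (fun j ↦ j ≤ i), two_mul]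
  apply add_le_add
  · refine le_trans (le_of_eq ?_) (sum_inv_succ_le k
      (J := (I.filter (fun j ↦ j ≤ i)).image (fun j ↦ i - j)) ?_)
    · rw [Finset.sum_image fun a ha b hb (hab : i - a = i - b) ↦ ?_]
      · refine Finset.sum_congr rfl fun j hj ↦ ?_
        have hj := (Finset.mem_filter.1 hj).2
        rw [Nat.cast_sub hj, abs_of_nonneg (sub_nonneg.2 (Nat.cast_le.2 hj))]
      · have := (Finset.mem_filter.1 ha).2
        have := (Finset.mem_filter.1 hb).2
        omega
    · intro l hl
      obtain ⟨j, -, rfl⟩ := Finset.mem_image.1 hl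
      exact Finset.mem_range.2 (by omega)
  · refine le_trans (le_of_eq ?_) (sum_inv_succ_le k
      (J := (I.filter (fun j ↦ ¬ j ≤ i)).image (fun j ↦ j - i)) ?_)
    · rw [Finset.sum_image fun a ha b hb (hab : a - i = b - i) ↦ ?_]
      · refine Finset.sum_congr rfl fun j hj ↦ ?_
        have hj := (not_le.1 (Finset.mem_filter.1 hj).2).le
        rw [Nat.cast_sub hj, abs_sub_comm, abs_of_nonneg (sub_nonneg.2 (Nat.cast_le.2 hj))]
      · have := (Finset.mem_filter.1 ha).2
        have := (Finset.mem_filter.1 hb).2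
        omega
    · intro l hl
      obtain ⟨j, hj, rfl⟩ := Finset.mem_image.1 hl
      have := Finset.mem_range.1 (hI (Finset.mem_filter.1 hj).1)
      exact Finset.mem_range.2 (by omega)

theorem card_cellsOnLine_inter_le {k i j : ℕ} {Q : Finset (ℤ × ℤ)} {m m' c c' x₀ x₀' : ℝ}
    (hi : i < 2 ^ k) (hj : j < 2 ^ k)
    (hm : m * 2 ^ k ∈ Set.Ico (i : ℝ) (i + 1)) (hm' : m' * 2 ^ k ∈ Set.Ico (j : ℝ) (j + 1)) :
    ((cellsOnLine k Q m c x₀ ∩ cellsOnLine k Q m' c' x₀').card : ℝ) ≤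
      27 * 2 ^ k * (|(i : ℝ) - j| + 1)⁻¹ := by
  have h2k : (0 : ℝ) < 2 ^ k := by positivity
  have hi1 : (i : ℝ) + 1 ≤ 2 ^ k := by exact_mod_cast hi
  have hj1 : (j : ℝ) + 1 ≤ 2 ^ k := by exact_mod_cast hj
  have unit : ∀ {l : ℕ} {a : ℝ}, (l : ℝ) + 1 ≤ 2 ^ k → a * 2 ^ k ∈ Set.Ico (l : ℝ) (l + 1) →
      a ∈ Set.Icc (0 : ℝ) 1 := by
    intro l a hl ha
    constructor
    · exact nonneg_of_mul_nonneg_left ((Nat.cast_nonneg l).trans ha.1) h2k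
    · nlinarith [ha.2]
  have hmI := unit hi1 hm
  have hmI' := unit hj1 hm'
  rw [← div_eq_mul_inv, le_div_iff₀ (by positivity)]
  have hd0 := abs_nonneg ((i : ℝ) - j)
  rcases lt_or_ge (|(i : ℝ) - j|) 2 with hd | hd
  · have h1 : ((cellsOnLine k Q m c x₀ ∩ cellsOnLine k Q m' c' x₀').card : ℝ) ≤ 5 * 2 ^ k :=
      le_trans (by exact_mod_cast Finset.card_le_card Finset.inter_subset_left)
        (card_cellsOnLine_le hmI (Q := Q) (c := c) (x₀ := x₀))
    calc _ ≤ (5 * 2 ^ k : ℝ) * (2 + 1) := by gcongr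
      _ ≤ _ := by linarith
  · have hsep : |(i : ℝ) - j| / 2 ≤ |m - m'| * 2 ^ k := by
      have h1 : |(i : ℝ) - j| - 1 ≤ |(m - m') * 2 ^ k| := by
        have h2 : |((i : ℝ) - j) - (m - m') * 2 ^ k| ≤ 1 := by
          rw [abs_le]
          constructor <;> nlinarith [hm.1, hm.2, hm'.1, hm'.2]
        linarith [abs_sub_abs_le_abs_sub ((i : ℝ) - j) ((m - m') * 2 ^ k)]
      rw [abs_mul, abs_of_pos h2k] at h1
      linarith
    have hpos : 0 < |m - m'| := pos_of_mul_pos_left (by linarith) h2k.le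
    have hcard := card_le_of_transversal (sub_ne_zero.1 (abs_pos.1 hpos))
      (A := cellsOnLine k Q m c x₀ ∩ cellsOnLine k Q m' c' x₀')
      (fun q hq ↦ abs_sub_lt_one_of_mem_cellsOnLine hmI (Finset.mem_inter.1 hq).1)
      (fun q hq ↦ abs_sub_lt_one_of_mem_cellsOnLine hmI' (Finset.mem_inter.1 hq).2)
    have hn : |(i : ℝ) - j| ≤ 2 ^ k := by
      rw [abs_le]
      constructor <;> linarith [(Nat.cast_nonneg i : (0 : ℝ) ≤ i), (Nat.cast_nonneg j : (0 : ℝ) ≤ j)]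
    have h4 : 4 / |m - m'| * |(i : ℝ) - j| ≤ 8 * 2 ^ k := by
      rw [div_mul_eq_mul_div, div_le_iff₀ hpos]
      nlinarith
    have h5 : 4 / |m - m'| * 2 ≤ 8 * 2 ^ k := by
      refine le_trans ?_ h4
      gcongr
    calc _ ≤ 2 * (4 / |m - m'| + 1) * (|(i : ℝ) - j| + 1) := by gcongr
      _ = 2 * (4 / |m - m'| * |(i : ℝ) - j|) + (4 / |m - m'| * 2) + 2 * |(i : ℝ) - j| + 2 := by
          ring
      _ ≤ _ := by linarith

/-- A discrete form of Córdoba's `L²` bound for the planar Kakeya maximal function. -/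
theorem card_mul_sq_le_of_volume_le {k : ℕ} {Q : Finset (ℤ × ℤ)} {I : Finset ℕ}
    (hI : I ⊆ Finset.range (2 ^ k)) {m c x₀ : ℕ → ℝ} {l : ℝ} (hl : 0 ≤ l)
    (hm : ∀ i ∈ I, m i * 2 ^ k ∈ Set.Ico (i : ℝ) (i + 1))
    (hvol : ∀ i ∈ I, ENNReal.ofReal l ≤ volume {x | x ∈ Set.Icc (x₀ i) (x₀ i + 1 / 2) ∧
      dyadicCell k x (m i * x + c i) ∈ Q}) :
    I.card * l ^ 2 * 2 ^ k ≤ 54 * (k + 1) * Q.card := by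
  classical
  have h2k : (0 : ℝ) < 2 ^ k := by positivity
  rcases I.eq_empty_or_nonempty with rfl | hne
  · simp only [Finset.card_empty, Nat.cast_zero, zero_mul]
    positivity
  have hN : (0 : ℝ) < I.card := by exact_mod_cast hne.card_pos
  set A : ℕ → Finset (ℤ × ℤ) := fun i ↦ cellsOnLine k Q (m i) (c i) (x₀ i)
  have hlow : ∀ i ∈ I, l * 2 ^ k ≤ (A i).card := by
    intro i hi
    have := (hvol i hi).trans (volume_le_card_cellsOnLine k Q (m i) (c i) (x₀ i))
    rwa [ENNReal.ofReal_le_ofReal_iff (by positivity), le_div_iff₀ h2k] at this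
  have h1 : I.card * (l * 2 ^ k) ≤ ∑ i ∈ I, ((A i).card : ℝ) := by
    rw [← nsmul_eq_mul]
    exact Finset.card_nsmul_le_sum _ _ _ hlow
  have h2 : ∑ i ∈ I, ∑ j ∈ I, ((A i ∩ A j).card : ℝ) ≤ I.card * (54 * (k + 1) * 2 ^ k) := by
    rw [← nsmul_eq_mul]
    refine Finset.sum_le_card_nsmul _ _ _ fun i hi ↦ ?_
    calc _ ≤ ∑ j ∈ I, 27 * 2 ^ k * (|(i : ℝ) - j| + 1)⁻¹ :=
          Finset.sum_le_sum fun j hj ↦ card_cellsOnLine_inter_le (Finset.mem_range.1 (hI hi))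
            (Finset.mem_range.1 (hI hj)) (hm i hi) (hm j hj)
      _ = 27 * 2 ^ k * ∑ j ∈ I, (|(i : ℝ) - j| + 1)⁻¹ := by rw [Finset.mul_sum]
      _ ≤ 27 * 2 ^ k * (2 * (k + 1)) := by
          gcongr
          exact sum_inv_abs_sub_le hI hi
      _ = _ := by ring
  have h3 : (I.card * (l * 2 ^ k)) ^ 2 ≤ Q.card * (I.card * (54 * (k + 1) * 2 ^ k) : ℝ) :=
    calc _ ≤ (∑ i ∈ I, ((A i).card : ℝ)) ^ 2 := by gcongr
      _ ≤ _ := sq_sum_card_le_card_mul_sum_card_inter I Q A fun i _ ↦ Finset.filter_subset _ _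
      _ ≤ _ := by gcongr
  refine le_of_mul_le_mul_right ?_ (mul_pos hN h2k)
  calc _ = (I.card * (l * 2 ^ k)) ^ 2 := by ring
    _ ≤ _ := h3
    _ = _ := by ring

theorem exists_geometric_le_volume {q a : ℝ} (hq0 : 0 < q) (hq1 : q < 1) (ha : 0 ≤ a)
    {S : ℕ → Set ℝ} (h : ENNReal.ofReal a < volume (⋃ k, S k)) :
    ∃ k, ENNReal.ofReal (a * (1 - q) * q ^ k) ≤ volume (S k) := by
  by_contra! hlt
  have hsum : HasSum (fun k : ℕ ↦ a * (1 - q) * q ^ k) a := by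
    have := (hasSum_geometric_of_lt_one hq0.le hq1).mul_left (a * (1 - q))
    rwa [mul_inv_cancel_right₀ (by linarith)] at this
  have hnn : ∀ k : ℕ, 0 ≤ a * (1 - q) * q ^ k := fun k ↦
    mul_nonneg (mul_nonneg ha (by linarith)) (by positivity)
  refine absurd h (not_lt.2 ?_)
  calc volume (⋃ k, S k) ≤ ∑' k, volume (S k) := measure_iUnion_le _
    _ ≤ ∑' k, ENNReal.ofReal (a * (1 - q) * q ^ k) := ENNReal.tsum_le_tsum fun k ↦ (hlt k).le
    _ = ENNReal.ofReal a := by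
        rw [← ENNReal.ofReal_tsum_of_nonneg hnn hsum.summable, hsum.tsum_eq]

theorem exists_finset_slopes (k : ℕ) {S : Set ℝ} (hS : S ⊆ Set.Ico 0 1) {v : ℝ}
    (hv : ENNReal.ofReal v ≤ volume S) :
    ∃ I ⊆ Finset.range (2 ^ k), v * 2 ^ k ≤ I.card ∧
      ∀ i ∈ I, ∃ m ∈ S, m * 2 ^ k ∈ Set.Ico (i : ℝ) (i + 1) := by
  classical
  have h2k : (0 : ℝ) < 2 ^ k := by positivity
  refine ⟨(Finset.range (2 ^ k)).filter fun i : ℕ ↦ ∃ m ∈ S, m * 2 ^ k ∈ Set.Ico (i : ℝ) (i + 1),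
    Finset.filter_subset _ _, ?_, fun i hi ↦ (Finset.mem_filter.1 hi).2⟩
  set I := (Finset.range (2 ^ k)).filter fun i : ℕ ↦ ∃ m ∈ S, m * 2 ^ k ∈ Set.Ico (i : ℝ) (i + 1)
  rw [← le_div_iff₀ h2k, ← ENNReal.ofReal_le_ofReal_iff (by positivity)]
  calc ENNReal.ofReal v ≤ volume S := hv
    _ ≤ volume (⋃ i ∈ I, Set.Ico ((i : ℝ) / 2 ^ k) ((i + 1) / 2 ^ k)) := by
        refine measure_mono fun m hm ↦ ?_
        have hm0 : 0 ≤ m * 2 ^ k := mul_nonneg (hS hm).1 h2k.le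
        have hmI : m * 2 ^ k ∈ Set.Ico (⌊m * 2 ^ k⌋₊ : ℝ) (⌊m * 2 ^ k⌋₊ + 1) :=
          ⟨Nat.floor_le hm0, Nat.lt_floor_add_one _⟩
        simp only [Set.mem_iUnion]
        refine ⟨⌊m * 2 ^ k⌋₊, Finset.mem_filter.2 ⟨Finset.mem_range.2 ?_, m, hm, hmI⟩, ?_⟩
        · rw [Nat.floor_lt hm0]
          push_cast
          nlinarith [(hS hm).2]
        · rwa [Set.mem_Ico, div_le_iff₀ h2k, lt_div_iff₀ h2k]
    _ ≤ ∑ i ∈ I, volume (Set.Ico ((i : ℝ) / 2 ^ k) ((i + 1) / 2 ^ k)) :=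
        measure_biUnion_finset_le _ _
    _ = ∑ i ∈ I, ENNReal.ofReal (1 / 2 ^ k) := by
        refine Finset.sum_congr rfl fun i _ ↦ ?_
        rw [Real.volume_Ico]
        congr 1
        ring
    _ = ENNReal.ofReal (I.card / 2 ^ k) := by
        rw [Finset.sum_const, nsmul_eq_mul, ← ENNReal.ofReal_natCast,
          ← ENNReal.ofReal_mul (by positivity)]
        congr 1
        ring

theorem succ_mul_pow_mul_le_one {q : ℝ} (hq0 : 0 < q) (hq1 : q < 1) (k : ℕ) :
    ((k : ℝ) + 1) * q ^ k * (1 - q) ≤ 1 := by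
  have h1 : ((k : ℝ) + 1) * q ^ k ≤ ∑ j ∈ Finset.range (k + 1), q ^ j := by
    have := Finset.card_nsmul_le_sum (Finset.range (k + 1)) (fun j ↦ q ^ j) (q ^ k) fun j hj ↦
      pow_le_pow_of_le_one hq0.le hq1.le (Nat.lt_succ_iff.1 (Finset.mem_range.1 hj))
    simpa using this
  have h2 : (∑ j ∈ Finset.range (k + 1), q ^ j) * (1 - q) = 1 - q ^ (k + 1) := by
    linarith [geom_sum_mul q (k + 1)]
  calc _ ≤ (∑ j ∈ Finset.range (k + 1), q ^ j) * (1 - q) := by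
        gcongr
    _ ≤ 1 := by
        rw [h2]
        linarith [pow_pos hq0 (k + 1)]

/-- Any family of dyadic cells covering a planar Kakeya set has, at some scale, almost the maximal
number of cells. -/
theorem exists_le_card_mul_pow {K : Set (EuclideanSpace ℝ (Fin 2))}
    (hK : ∀ ω : EuclideanSpace ℝ (Fin 2), ‖ω‖ = 1 →
      ∃ a : EuclideanSpace ℝ (Fin 2), ∀ t ∈ Set.Icc (0 : ℝ) 1, a + t • ω ∈ K)
    {Q : ℕ → Finset (ℤ × ℤ)} (hQ : ∀ p ∈ K, ∃ k, dyadicCell k (p 0) (p 1) ∈ Q k)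
    {q : ℝ} (hq0 : 0 < q) (hq1 : q < 1) :
    ∃ k, (1 - q) ^ 4 * (4 * q ^ 4) ^ k ≤ 1728 * (Q k).card := by
  have hline : ∀ m : ℝ, ∃ x₀ c : ℝ, m ∈ Set.Icc (0 : ℝ) 1 →
      ∀ x ∈ Set.Icc x₀ (x₀ + 1 / 2), !₂[x, m * x + c] ∈ K := by
    intro m
    by_cases hm : m ∈ Set.Icc (0 : ℝ) 1
    · obtain ⟨x₀, c, h⟩ := exists_segment_of_slope hK hm
      exact ⟨x₀, c, fun _ ↦ h⟩
    · exact ⟨0, 0, fun h ↦ absurd h hm⟩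
  choose x₀ c hline using hline
  set X : ℕ → ℝ → Set ℝ := fun k m ↦ {x | x ∈ Set.Icc (x₀ m) (x₀ m + 1 / 2) ∧
    dyadicCell k x (m * x + c m) ∈ Q k}
  set S : ℕ → Set ℝ := fun k ↦ {m | m ∈ Set.Ico (0 : ℝ) 1 ∧
    ENNReal.ofReal (1 / 4 * (1 - q) * q ^ k) ≤ volume (X k m)}
  have hcover : Set.Ico (0 : ℝ) 1 ⊆ ⋃ k, S k := by
    intro m hm
    obtain ⟨k, hk⟩ := exists_geometric_le_volume (a := 1 / 4) (S := fun k ↦ X k m) hq0 hq1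
      (by norm_num) (by
        refine lt_of_lt_of_le ?_ (measure_mono (s := Set.Icc (x₀ m) (x₀ m + 1 / 2)) ?_)
        · rw [Real.volume_Icc, ENNReal.ofReal_lt_ofReal_iff] <;> linarith
        · intro x hx
          obtain ⟨k, hk⟩ := hQ _ (hline m ⟨hm.1, hm.2.le⟩ x hx)
          exact Set.mem_iUnion.2 ⟨k, hx, by simpa using hk⟩)
    exact Set.mem_iUnion.2 ⟨k, hm, hk⟩
  obtain ⟨k, hk⟩ := exists_geometric_le_volume (a := 1 / 2) (S := S) hq0 hq1 (by norm_num) (by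
    refine lt_of_lt_of_le ?_ (measure_mono hcover)
    rw [Real.volume_Ico, ENNReal.ofReal_lt_ofReal_iff] <;> linarith)
  obtain ⟨I, hI, hIcard, hIm⟩ := exists_finset_slopes k (fun m hm ↦ hm.1) hk
  choose! m hmS hmI using hIm
  have hq1' : 0 < 1 - q := by linarith
  have hmain := card_mul_sq_le_of_volume_le hI (m := m) (c := fun i ↦ c (m i))
    (x₀ := fun i ↦ x₀ (m i)) (Q := Q k) (l := 1 / 4 * (1 - q) * q ^ k) (by positivity) hmI
    fun i hi ↦ (hmS i hi).2
  refine ⟨k, ?_⟩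
  have hlow : 1 / 2 * (1 - q) * q ^ k * 2 ^ k * (1 / 4 * (1 - q) * q ^ k) ^ 2 * 2 ^ k ≤
      54 * (k + 1) * (Q k).card := le_trans (by gcongr) hmain
  have h4 : (4 : ℝ) ^ k = 2 ^ k * 2 ^ k := by rw [← mul_pow]; norm_num
  calc (1 - q) ^ 4 * (4 * q ^ 4) ^ k
      = 32 * (1 / 2 * (1 - q) * q ^ k * 2 ^ k * (1 / 4 * (1 - q) * q ^ k) ^ 2 * 2 ^ k) *
        (q ^ k * (1 - q)) := by
        rw [mul_pow, h4]
        ring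
    _ ≤ 32 * (54 * (k + 1) * (Q k).card) * (q ^ k * (1 - q)) := by gcongr
    _ = 1728 * (Q k).card * ((k + 1) * q ^ k * (1 - q)) := by ring
    _ ≤ 1728 * (Q k).card * 1 := by
        gcongr
        exact succ_mul_pow_mul_le_one hq0 hq1 k
    _ = _ := by ring

theorem hausdorffMeasure_ne_zero_of_forall_segment {K : Set (EuclideanSpace ℝ (Fin 2))}
    (hK : ∀ ω : EuclideanSpace ℝ (Fin 2), ‖ω‖ = 1 →
      ∃ a : EuclideanSpace ℝ (Fin 2), ∀ t ∈ Set.Icc (0 : ℝ) 1, a + t • ω ∈ K)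
    {s : ℝ} (hs0 : 0 < s) (hs2 : s < 2) : μH[s] K ≠ 0 := by
  intro h0
  obtain ⟨q, hq⟩ : ∃ q : ℝ, q = (1 / 2) ^ ((2 - s) / 4) := ⟨_, rfl⟩
  have hq0 : 0 < q := hq ▸ by positivity
  have hq1 : q < 1 := hq ▸ Real.rpow_lt_one (by norm_num) (by norm_num) (by linarith)
  have hqs : 4 * q ^ 4 * (1 / 2 : ℝ) ^ s = 1 := by
    rw [hq, ← Real.rpow_mul_natCast (by norm_num), mul_assoc, ← Real.rpow_add (by norm_num)]
    have : (2 - s) / 4 * (4 : ℕ) + s = (2 : ℕ) := by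
      push_cast
      ring
    rw [this, Real.rpow_natCast]
    norm_num
  have hc : 0 < (1 - q) ^ 4 := pow_pos (by linarith) 4
  obtain ⟨Q, hQ, hcard⟩ := exists_dyadicCell_cover hs0
    (show 0 < (1 - q) ^ 4 / 20000 by positivity) h0
  obtain ⟨k, hk⟩ := exists_le_card_mul_pow hK hQ hq0 hq1
  have hpk : 0 < ((1 / 2 : ℝ) ^ s) ^ k := by positivity
  have : (1 - q) ^ 4 ≤ 1728 * (9 * ((1 - q) ^ 4 / 20000)) :=
    calc (1 - q) ^ 4 = (1 - q) ^ 4 * (4 * q ^ 4) ^ k * ((1 / 2 : ℝ) ^ s) ^ k := by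
          rw [mul_assoc, ← mul_pow, hqs, one_pow, mul_one]
      _ ≤ 1728 * (Q k).card * ((1 / 2 : ℝ) ^ s) ^ k := by gcongr
      _ = 1728 * ((Q k).card * ((1 / 2 : ℝ) ^ s) ^ k) := by ring
      _ ≤ _ := mul_le_mul_of_nonneg_left (hcard k) (by norm_num)
  linarith

/-- **Davies's theorem**: every Kakeya set `K ⊆ ℝ²` has Hausdorff dimension `2`. -/
theorem davies_planar_kakeya (K : Set (EuclideanSpace ℝ (Fin 2))) (hK : IsKakeya K) :
    dimH K = 2 := by
  apply le_antisymm
  · calc dimH K ≤ dimH (Set.univ : Set (EuclideanSpace ℝ (Fin 2))) := dimH_mono (Set.subset_univ K)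
      _ = 2 := by
        rw [Real.dimH_univ_eq_finrank, finrank_euclideanSpace_fin]
        norm_num
  · refine ENNReal.le_of_forall_nnreal_lt fun r hr ↦ ?_
    rcases eq_zero_or_pos r with rfl | hr0
    · simp
    · refine le_dimH_of_hausdorffMeasure_ne_zero
        (hausdorffMeasure_ne_zero_of_forall_segment hK.2 (by exact_mod_cast hr0) ?_)
      have : r < 2 := by exact_mod_cast hr
      exact_mod_cast this
end

section
/- Edgar–Miller theorem: let S be a subring of ℝ (a subset containing 0 and 1 and closed under addition, negation and multiplication) which is a Borel set. Then either S has Hausdorff dimension 0, or S = ℝ. -/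
open MeasureTheory Set
open scoped ENNReal

/-- The half-open dyadic interval of level `n` and index `j`. -/
def dyadicIco (n : ℕ) (j : ℤ) : Set ℝ := {x | ⌊x * 2 ^ n⌋ = j}

theorem mem_dyadicIco {n : ℕ} {j : ℤ} {x : ℝ} : x ∈ dyadicIco n j ↔ ⌊x * 2 ^ n⌋ = j := Iff.rfl

theorem dyadicIco_eq_Ico (n : ℕ) (j : ℤ) :
    dyadicIco n j = Ico ((j : ℝ) / 2 ^ n) ((j + 1) / 2 ^ n) := by
  ext x
  rw [mem_dyadicIco, Int.floor_eq_iff, mem_Ico, div_le_iff₀ (by positivity),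
    lt_div_iff₀ (by positivity)]

theorem measurableSet_dyadicIco (n : ℕ) (j : ℤ) : MeasurableSet (dyadicIco n j) := by
  rw [dyadicIco_eq_Ico]; exact measurableSet_Ico

theorem floor_mul_two_pow_succ (n : ℕ) (x : ℝ) : ⌊x * 2 ^ n⌋ = ⌊x * 2 ^ (n + 1)⌋ / 2 := by
  have h : x * 2 ^ n = x * 2 ^ (n + 1) / ((2 : ℕ) : ℝ) := by push_cast; ring
  rw [h, Int.floor_div_natCast]; rfl

theorem dyadicIco_succ (n : ℕ) (j : ℤ) :
    dyadicIco n j = dyadicIco (n + 1) (2 * j) ∪ dyadicIco (n + 1) (2 * j + 1) := by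
  ext x
  simp only [mem_union, mem_dyadicIco, floor_mul_two_pow_succ n x]
  omega

theorem volume_dyadicIco (n : ℕ) (j : ℤ) : volume (dyadicIco n j) = (2⁻¹ : ℝ≥0∞) ^ n := by
  rw [dyadicIco_eq_Ico, Real.volume_Ico, ← sub_div, add_sub_cancel_left, one_div,
    ← ENNReal.inv_pow, ENNReal.ofReal_inv_of_pos (by positivity), ENNReal.ofReal_pow (by norm_num)]
  simp

theorem dyadicIco_disjoint_of_ne {n m : ℕ} {j i l : ℤ} (h : n ≤ m) (hij : i ≠ j) 
    (h1 : (dyadicIco m l ∩ dyadicIco n i).Nonempty) : Disjoint (dyadicIco m l) (dyadicIco n j) := by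
  have key : ∀ d : ℕ, ∀ x y : ℝ, ⌊x * 2 ^ (n + d)⌋ = ⌊y * 2 ^ (n + d)⌋ → 
      ⌊x * 2 ^ n⌋ = ⌊y * 2 ^ n⌋ := by
    intro d x y
    induction d with
    | zero => exact id
    | succ d ih =>
      intro hd
      refine ih ?_
      rw [floor_mul_two_pow_succ _ x, floor_mul_two_pow_succ _ y, add_assoc, hd]
  obtain ⟨d, rfl⟩ := Nat.exists_eq_add_of_le h
  obtain ⟨x, hx1, hx2⟩ := h1
  rw [Set.disjoint_left]
  intro y hy1 hy2
  rw [mem_dyadicIco] at *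
  exact hij (by rw [← hx2, ← hy2]; exact key d x y (by rw [hx1, hy1]))

/-- `a` is the mass of a measure carried by `W ∩ dyadicIco l j` giving mass at most `t ^ n` to
each dyadic interval of level `n`. -/
def IsDyadicMass (t : ℝ≥0∞) (W : Set ℝ) (l : ℕ) (j : ℤ) (a : ℝ≥0∞) : Prop :=
  ∃ μ : Measure ℝ, μ univ = a ∧ μ (W ∩ dyadicIco l j)ᶜ = 0 ∧ ∀ n i, μ (dyadicIco n i) ≤ t ^ n

section
variable {t : ℝ≥0∞} {W : Set ℝ} {l : ℕ} {j : ℤ} {a b : ℝ≥0∞}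

theorem IsDyadicMass.le (h : IsDyadicMass t W l j a) : a ≤ t ^ l := by
  obtain ⟨μ, rfl, h0, hμ⟩ := h
  refine le_trans ?_ (hμ l j)
  rw [← union_compl_self (W ∩ dyadicIco l j)]
  refine (measure_union_le _ _).trans ?_
  rw [h0, add_zero]
  exact measure_mono inter_subset_right

theorem IsDyadicMass.mono (ht : t ≤ 1) (h : IsDyadicMass t W l j a) (hb : b ≤ a) :
    IsDyadicMass t W l j b := by
  have ha : a ≠ ∞ := ne_top_of_le_ne_top ENNReal.one_ne_top (h.le.trans (pow_le_one₀ zero_le ht))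
  obtain ⟨μ, rfl, h0, hμ⟩ := h
  have hle : b / μ univ ≤ 1 := ENNReal.div_le_of_le_mul (by simpa using hb)
  refine ⟨(b / μ univ) • μ, ?_, by simp [h0], fun n i => ?_⟩
  · rw [Measure.smul_apply, smul_eq_mul]
    rcases eq_or_ne (μ univ) 0 with h | h
    · rw [h] at hb ⊢; simp [le_zero_iff.1 hb]
    · exact ENNReal.div_mul_cancel h ha
  · rw [Measure.smul_apply, smul_eq_mul]
    exact (mul_le_of_le_one_left zero_le hle).trans (hμ n i)

theorem isDyadicMass_of_subset (ht : t ≤ 1) (ht' : 2⁻¹ ≤ t) (h : dyadicIco l j ⊆ W) :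
    IsDyadicMass t W l j (t ^ l) := by
  have hinv : (2 : ℝ≥0∞) ^ l * 2⁻¹ ^ l = 1 := by
    rw [← mul_pow, ENNReal.mul_inv_cancel (by simp) (by simp), one_pow]
  have hu : ((t ^ l * 2 ^ l) • volume.restrict (dyadicIco l j)) univ = t ^ l := by
    rw [Measure.smul_apply, Measure.restrict_apply_univ, volume_dyadicIco, smul_eq_mul, mul_assoc,
      hinv, mul_one]
  refine ⟨(t ^ l * 2 ^ l) • volume.restrict (dyadicIco l j), hu, ?_, fun n i => ?_⟩
  · rw [inter_eq_right.2 h, Measure.smul_apply, Measure.restrict_apply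
      (measurableSet_dyadicIco _ _).compl, compl_inter_self]
    simp
  · rcases le_total n l with hn | hn
    · exact (measure_mono (subset_univ _)).trans (hu.trans_le (pow_le_pow_of_le_one zero_le ht hn))
    · obtain ⟨m, rfl⟩ := Nat.exists_eq_add_of_le hn
      calc _ ≤ (t ^ l * 2 ^ l) * volume (dyadicIco (l + m) i) := by
            rw [Measure.smul_apply, smul_eq_mul]; gcongr; exact Measure.restrict_le_self
        _ = t ^ l * 2⁻¹ ^ m := by
            rw [volume_dyadicIco, pow_add, mul_assoc, ← mul_assoc (2 ^ l), hinv, one_mul]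
        _ ≤ _ := by rw [pow_add]; gcongr

theorem IsDyadicMass.add (ht : t ≤ 1) (ha : IsDyadicMass t W (l + 1) (2 * j) a)
    (hb : IsDyadicMass t W (l + 1) (2 * j + 1) b) (hab : a + b ≤ t ^ l) :
    IsDyadicMass t W l j (a + b) := by
  obtain ⟨μ, rfl, hμ0, hμ⟩ := ha
  obtain ⟨ν, rfl, hν0, hν⟩ := hb
  refine ⟨μ + ν, rfl, ?_, fun n i => ?_⟩
  · rw [Measure.add_apply, add_eq_zero, dyadicIco_succ]
    exact ⟨measure_mono_null (compl_subset_compl.2 (by gcongr; exact subset_union_left)) hμ0,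
      measure_mono_null (compl_subset_compl.2 (by gcongr; exact subset_union_right)) hν0⟩
  · rcases le_or_gt n l with hn | hn
    · exact (measure_mono (subset_univ _)).trans (hab.trans (pow_le_pow_of_le_one zero_le ht hn))
    · rw [Measure.add_apply]
      by_cases h : (dyadicIco n i ∩ dyadicIco (l + 1) (2 * j)).Nonempty
      · have : ν (dyadicIco n i) = 0 := by
          refine measure_mono_null (fun x hx => ?_) hν0
          exact fun h2 => (Set.disjoint_left.1 (dyadicIco_disjoint_of_ne
            (by omega) (by omega) h) hx) h2.2
        rw [this, add_zero]; exact hμ n i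
      · have : μ (dyadicIco n i) = 0 := 
          measure_mono_null (fun x hx (h2 : x ∈ W ∩ _) => h ⟨x, hx, h2.2⟩) hμ0
        rw [this, zero_add]; exact hν n i

/-- The largest mass of a measure as in `IsDyadicMass`. -/
noncomputable def dyadicMass (t : ℝ≥0∞) (W : Set ℝ) (l : ℕ) (j : ℤ) : ℝ≥0∞ :=
  sSup {a | IsDyadicMass t W l j a}

theorem dyadicMass_le : dyadicMass t W l j ≤ t ^ l := sSup_le fun _ h => h.le

theorem dyadicMass_of_subset (ht : t ≤ 1) (ht' : 2⁻¹ ≤ t) (h : dyadicIco l j ⊆ W) :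
    dyadicMass t W l j = t ^ l :=
  le_antisymm dyadicMass_le (le_sSup (isDyadicMass_of_subset ht ht' h))

theorem dyadicMass_succ_add_le (ht : t ≤ 1) (h : dyadicMass t W l j ≠ t ^ l) :
    dyadicMass t W (l + 1) (2 * j) + dyadicMass t W (l + 1) (2 * j + 1) ≤ dyadicMass t W l j := by
  by_contra! hlt
  obtain ⟨c, hc, hc'⟩ := exists_between (lt_min hlt (lt_of_le_of_ne dyadicMass_le h))
  rw [lt_min_iff] at hc'
  have hne : ∀ l j, {a | IsDyadicMass t W l j a}.Nonempty := fun l j => ⟨0, 0, by simp⟩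
  obtain ⟨a, ha, b, hb, hab⟩ : ∃ a, IsDyadicMass t W (l + 1) (2 * j) a ∧
      ∃ b, IsDyadicMass t W (l + 1) (2 * j + 1) b ∧ c < a + b := by
    by_contra! H
    refine hc'.1.not_ge ?_
    unfold dyadicMass
    rw [ENNReal.sSup_add (hne _ _)]
    refine iSup₂_le fun a ha => ?_
    rw [ENNReal.add_sSup (hne _ _)]
    exact iSup₂_le fun b hb => H a ha b hb
  have hsum : min a c + (c - min a c) = c := add_tsub_cancel_of_le (min_le_right _ _)
  refine hc.not_ge (le_sSup ?_)
  rw [mem_ofPred_eq, ← hsum]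
  refine (ha.mono ht (min_le_left _ _)).add ht (hb.mono ht ?_) (hsum.trans_le hc'.2.le)
  rcases le_total a c with h1 | h1
  · rw [min_eq_left h1]; exact tsub_le_iff_left.2 hab.le
  · simp [h1]

open Classical in
/-- Total weight of the maximal saturated intervals that lie `k` levels below the given one. -/
noncomputable def saturatedWeight (t : ℝ≥0∞) (W : Set ℝ) : ℕ → ℕ → ℤ → ℝ≥0∞
  | 0, l, j => if dyadicMass t W l j = t ^ l then t ^ l else 0
  | k + 1, l, j => if dyadicMass t W l j = t ^ l then 0 else
      saturatedWeight t W k (l + 1) (2 * j) + saturatedWeight t W k (l + 1) (2 * j + 1)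

open Classical in
/-- Union of the maximal saturated intervals that lie `k` levels below the given one. -/
noncomputable def saturatedUnion (t : ℝ≥0∞) (W : Set ℝ) : ℕ → ℕ → ℤ → Set ℝ
  | 0, l, j => if dyadicMass t W l j = t ^ l then dyadicIco l j else ∅
  | k + 1, l, j => if dyadicMass t W l j = t ^ l then ∅ else
      saturatedUnion t W k (l + 1) (2 * j) ∪ saturatedUnion t W k (l + 1) (2 * j + 1)

theorem sum_saturatedWeight_le (ht : t ≤ 1) (k l : ℕ) (j : ℤ) :
    ∑ i ∈ Finset.range k, saturatedWeight t W i l j ≤ dyadicMass t W l j := by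
  induction k generalizing l j with
  | zero => simp
  | succ k ih =>
    rw [Finset.sum_range_succ']
    by_cases h : dyadicMass t W l j = t ^ l
    · simp [saturatedWeight, h]
    · simp only [saturatedWeight, h, if_false, Finset.sum_add_distrib, add_zero]
      exact (add_le_add (ih _ _) (ih _ _)).trans (dyadicMass_succ_add_le ht h)

theorem measure_saturatedUnion_le (M : OuterMeasure ℝ) (hM : ∀ n i, M (dyadicIco n i) ≤ t ^ n)
    (k l : ℕ) (j : ℤ) : M (saturatedUnion t W k l j) ≤ saturatedWeight t W k l j := by
  induction k generalizing l j with
  | zero =>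
    by_cases h : dyadicMass t W l j = t ^ l <;> simp [saturatedUnion, saturatedWeight, h, hM]
  | succ k ih =>
    by_cases h : dyadicMass t W l j = t ^ l
    · simp [saturatedUnion, saturatedWeight, h]
    · simp only [saturatedUnion, saturatedWeight, h, if_false]
      exact (measure_union_le _ _).trans (add_le_add (ih _ _) (ih _ _))

theorem exists_mem_saturatedUnion {x : ℝ} (m : ℕ) (hx : x ∈ dyadicIco l j)
    (hm : ∃ i, x ∈ dyadicIco (l + m) i ∧ dyadicMass t W (l + m) i = t ^ (l + m)) :
    ∃ k, x ∈ saturatedUnion t W k l j := by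
  induction m generalizing l j with
  | zero =>
    obtain ⟨i, hi, h⟩ := hm
    obtain rfl : i = j := hi.symm.trans hx
    rw [add_zero] at h
    exact ⟨0, by simpa [saturatedUnion, h] using hx⟩
  | succ m ih =>
    by_cases h : dyadicMass t W l j = t ^ l
    · exact ⟨0, by simpa [saturatedUnion, h] using hx⟩
    · rw [show l + (m + 1) = l + 1 + m by ring] at hm
      rw [dyadicIco_succ] at hx
      rcases hx with hx | hx <;> obtain ⟨k, hk⟩ := ih hx hm <;>
        exact ⟨k + 1, by simp [saturatedUnion, h, hk]⟩

theorem exists_dyadicIco_subset (hW : IsOpen W) {x : ℝ} (hx : x ∈ W) (l : ℕ) :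
    ∃ m i, x ∈ dyadicIco (l + m) i ∧ dyadicIco (l + m) i ⊆ W := by
  obtain ⟨ε, hε, hb⟩ := Metric.isOpen_iff.1 hW x hx
  obtain ⟨n, hn⟩ := exists_pow_lt_of_lt_one hε (show (1 / 2 : ℝ) < 1 by norm_num)
  refine ⟨n, _, rfl, fun y hy => hb ?_⟩
  rw [mem_dyadicIco, Int.floor_eq_iff] at hy
  have h1 := Int.floor_le (x * 2 ^ (l + n))
  have h2 := Int.lt_floor_add_one (x * 2 ^ (l + n))
  have h3 : |y - x| * 2 ^ (l + n) < 1 := by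
    rw [← abs_of_pos (show (0 : ℝ) < 2 ^ (l + n) by positivity), ← abs_mul, abs_lt]
    constructor <;> linarith
  have h4 : |y - x| * 2 ^ n ≤ |y - x| * 2 ^ (l + n) := by
    gcongr
    · norm_num
    · omega
  rw [Metric.mem_ball, Real.dist_eq]
  refine lt_of_lt_of_le ?_ hn.le
  rw [one_div, inv_pow, ← one_div, lt_div_iff₀ (by positivity)]
  linarith

/-- A set function dominated by `t ^ n` on dyadic intervals of level `n` is dominated on open
sets by masses of measures with the same growth. -/
theorem outerMeasure_inter_dyadicIco_le (ht : t ≤ 1) (ht' : 2⁻¹ ≤ t) (M : OuterMeasure ℝ)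
    (hM : ∀ n i, M (dyadicIco n i) ≤ t ^ n) (hW : IsOpen W) :
    M (W ∩ dyadicIco l j) ≤ dyadicMass t W l j := by
  have hsub : W ∩ dyadicIco l j ⊆ ⋃ k, saturatedUnion t W k l j := by
    rintro x ⟨hx, hx'⟩
    obtain ⟨m, i, hi, h⟩ := exists_dyadicIco_subset hW hx l
    exact mem_iUnion.2 (exists_mem_saturatedUnion m hx' ⟨i, hi, dyadicMass_of_subset ht ht' h⟩)
  calc M (W ∩ dyadicIco l j) ≤ ∑' k, M (saturatedUnion t W k l j) :=
        (measure_mono hsub).trans (measure_iUnion_le _)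
    _ ≤ ∑' k, saturatedWeight t W k l j :=
        ENNReal.tsum_le_tsum fun k => measure_saturatedUnion_le M hM k l j
    _ ≤ _ := ENNReal.tsum_le_of_sum_range_le fun k => sum_saturatedWeight_le ht k l j

end

/-- A uniform Frostman condition of growth rate `t` on an arbitrary set `A`, tested on its open
neighbourhoods. -/
def IsFrostman {X : Type*} [PseudoMetricSpace X] [MeasurableSpace X] (t : ℝ≥0∞) (A : Set X) :
    Prop :=
  ∃ c C : ℝ≥0∞, c ≠ 0 ∧ C ≠ ∞ ∧ ∀ V, IsOpen V → A ⊆ V → ∃ μ : Measure X, μ Vᶜ = 0 ∧ c ≤ μ univ ∧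
    μ univ ≤ C ∧ ∀ (n : ℕ) x, μ (Metric.closedBall x (2⁻¹ ^ n)) ≤ C * t ^ n

theorem closedBall_subset_dyadicIco (n : ℕ) (x : ℝ) :
    Metric.closedBall x (2⁻¹ ^ n) ⊆ dyadicIco n (⌊x * 2 ^ n⌋ - 1) ∪ dyadicIco n ⌊x * 2 ^ n⌋ ∪
      dyadicIco n (⌊x * 2 ^ n⌋ + 1) := by
  intro y hy
  rw [Metric.mem_closedBall, Real.dist_eq, inv_pow, ← one_div, le_div_iff₀ (by positivity),
    ← abs_of_pos (show (0 : ℝ) < 2 ^ n by positivity), ← abs_mul, abs_le] at hy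
  simp only [mem_union, mem_dyadicIco]
  have h1 : ⌊x * 2 ^ n - 1⌋ ≤ ⌊y * 2 ^ n⌋ := Int.floor_le_floor (by linarith)
  have h2 : ⌊y * 2 ^ n⌋ ≤ ⌊x * 2 ^ n + 1⌋ := Int.floor_le_floor (by linarith)
  rw [Int.floor_sub_one] at h1
  rw [Int.floor_add_one] at h2
  omega

theorem isFrostman_of_outerMeasure_ne_zero {t : ℝ≥0∞} (ht : t ≤ 1) (ht' : 2⁻¹ ≤ t)
    (M : OuterMeasure ℝ) (hM : ∀ n i, M (dyadicIco n i) ≤ t ^ n) {K : Set ℝ} {j : ℤ}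
    (hK : K ⊆ dyadicIco 0 j) (h0 : M K ≠ 0) : IsFrostman t K := by
  have hfin : M K ≠ ∞ := ne_top_of_le_ne_top ENNReal.one_ne_top
    ((measure_mono hK).trans ((hM 0 j).trans (by simp)))
  refine ⟨M K / 2, 3, by simpa using h0, by simp, fun V hV hKV => ?_⟩
  have hlt : M K / 2 < dyadicMass t V 0 j :=
    (ENNReal.half_lt_self h0 hfin).trans_le ((measure_mono (subset_inter hKV hK)).trans
      (outerMeasure_inter_dyadicIco_le ht ht' M hM hV))
  obtain ⟨a, ha, hlt⟩ := lt_sSup_iff.1 hlt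
  have ha1 := ha.le
  obtain ⟨μ, rfl, hμ0, hμ⟩ := ha
  refine ⟨μ, measure_mono_null (compl_subset_compl.2 inter_subset_left) hμ0, hlt.le,
    ha1.trans (by norm_num), fun n x => ?_⟩
  refine (measure_mono (closedBall_subset_dyadicIco n x)).trans ?_
  refine (measure_union_le _ _).trans ((add_le_add_left (measure_union_le _ _) _).trans ?_)
  refine (add_le_add (add_le_add (hμ _ _) (hμ _ _)) (hμ _ _)).trans_eq ?_
  ring

/-- The Hausdorff content of dimension `s`. -/
noncomputable def hausdorffContent (s : ℝ) : OuterMeasure ℝ :=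
  OuterMeasure.boundedBy fun A => Metric.ediam A ^ s

theorem hausdorffMeasure_eq_zero_of_content {s : ℝ} (hs : 0 < s) {K : Set ℝ}
    (h : hausdorffContent s K = 0) : Measure.hausdorffMeasure s K = 0 := by
  rw [Measure.hausdorffMeasure_apply, ← le_zero_iff]
  refine iSup₂_le fun r hr => le_of_forall_gt_imp_ge_of_dense fun ε hε => ?_
  have hlt : hausdorffContent s K < min ε (r ^ s) := by
    rw [h]; exact lt_min hε (ENNReal.rpow_pos_of_nonneg hr hs.le)
  rw [hausdorffContent, OuterMeasure.boundedBy_apply] at hlt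
  simp only [iInf_lt_iff] at hlt
  obtain ⟨t, ht, hlt⟩ := hlt
  refine iInf_le_of_le t (iInf_le_of_le ht (iInf_le_of_le (fun n => ?_)
    (hlt.le.trans (min_le_left _ _))))
  rcases (t n).eq_empty_or_nonempty with h0 | h0
  · simp [h0]
  · rw [← ENNReal.rpow_le_rpow_iff hs]
    refine le_trans ?_ (hlt.le.trans (min_le_right _ _))
    exact le_trans (le_iSup_of_le h0 le_rfl)
      (ENNReal.le_tsum (f := fun n => ⨆ _ : (t n).Nonempty, Metric.ediam (t n) ^ s) n)

theorem hausdorffContent_dyadicIco_le {s : ℝ} (n : ℕ) (i : ℤ) :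
    hausdorffContent s (dyadicIco n i) ≤ ((2⁻¹ : ℝ≥0∞) ^ s) ^ n := by
  refine (OuterMeasure.boundedBy_le _).trans_eq ?_
  have h := volume_dyadicIco n i
  rw [dyadicIco_eq_Ico] at h ⊢
  rw [Real.ediam_Ico, ← Real.volume_Ico, h, ← ENNReal.rpow_natCast, ← ENNReal.rpow_natCast,
    ← ENNReal.rpow_mul, ← ENNReal.rpow_mul, mul_comm]

/-- A set of positive Hausdorff dimension has a bounded piece satisfying a Frostman condition. -/
theorem exists_isFrostman_of_dimH_ne_zero {S : Set ℝ} (h : dimH S ≠ 0) :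
    ∃ t < 1, ∃ j, IsFrostman t (S ∩ dyadicIco 0 j) := by
  obtain ⟨s, hs0, hs⟩ := ENNReal.lt_iff_exists_nnreal_btwn.1
    (lt_min (pos_iff_ne_zero.2 h) one_pos)
  rw [lt_min_iff] at hs
  have hs0' : 0 < (s : ℝ) := by exact_mod_cast hs0
  have hs1 : (s : ℝ) ≤ 1 := by exact_mod_cast hs.2.le
  have hS : hausdorffContent s S ≠ 0 := fun h0 => by
    have := hausdorffMeasure_of_lt_dimH hs.1
    rw [hausdorffMeasure_eq_zero_of_content hs0' h0] at this
    exact ENNReal.zero_ne_top this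
  obtain ⟨j, hj⟩ : ∃ j, hausdorffContent s (S ∩ dyadicIco 0 j) ≠ 0 := by
    by_contra! H
    refine hS (le_zero_iff.1 ?_)
    have hsub : S ⊆ ⋃ j, S ∩ dyadicIco 0 j := fun x hx => mem_iUnion.2 ⟨_, hx, rfl⟩
    refine (measure_mono hsub).trans ((measure_iUnion_le _).trans ?_)
    simp [H]
  refine ⟨2⁻¹ ^ (s : ℝ), ENNReal.rpow_lt_one (by simp) hs0', j,
    isFrostman_of_outerMeasure_ne_zero (ENNReal.rpow_lt_one (by simp) hs0').le ?_
    (hausdorffContent s) hausdorffContent_dyadicIco_le inter_subset_right hj⟩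
  simpa using ENNReal.rpow_le_rpow_of_exponent_ge (x := 2⁻¹) (by simp) hs1

theorem IsFrostman.exists_isCompact {X : Type*} [MetricSpace X] [MeasurableSpace X]
    [BorelSpace X] [ProperSpace X] {t : ℝ≥0∞} {A : Set X} (h : IsFrostman t A) :
    ∃ c C : ℝ≥0∞, c ≠ 0 ∧ C ≠ ∞ ∧ ∀ V, IsOpen V → A ⊆ V → ∃ μ : Measure X, ∃ F ⊆ V, IsCompact F ∧
      μ Fᶜ = 0 ∧ c ≤ μ univ ∧ μ univ ≤ C ∧
      ∀ (n : ℕ) x, μ (Metric.closedBall x (2⁻¹ ^ n)) ≤ C * t ^ n := by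
  obtain ⟨c, C, hc, hC, h⟩ := h
  refine ⟨min c 1 / 2, C, by simp [hc], hC, fun V hV hAV => ?_⟩
  obtain ⟨μ, hμ0, hμc, hμC, hμ⟩ := h V hV hAV
  have : IsFiniteMeasure μ := ⟨hμC.trans_lt hC.lt_top⟩
  have hV' : min c 1 / 2 < μ V := by
    have h1 : μ univ ≤ μ V := by
      rw [← union_compl_self V]; exact (measure_union_le _ _).trans (by rw [hμ0, add_zero])
    refine (ENNReal.half_lt_self (by simp [hc]) ?_).trans_le ((min_le_left _ _).trans (hμc.trans h1))
    exact ne_top_of_le_ne_top ENNReal.one_ne_top (min_le_right _ _)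
  obtain ⟨F, hFV, hF, hlt⟩ := hV.exists_lt_isCompact hV'
  refine ⟨μ.restrict F, F, hFV, hF, ?_, ?_, ?_, fun n x => ?_⟩
  · rw [Measure.restrict_apply hF.measurableSet.compl, compl_inter_self,
      measure_empty]
  · rw [Measure.restrict_apply_univ]; exact hlt.le
  · exact (Measure.restrict_apply_le _ _).trans hμC
  · exact (Measure.restrict_apply_le _ _).trans (hμ n x)

theorem IsFrostman.prod {X Y : Type*} [MetricSpace X] [MeasurableSpace X] [BorelSpace X]
    [ProperSpace X] [MetricSpace Y] [MeasurableSpace Y] [BorelSpace Y]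
    [SecondCountableTopology Y] {t u : ℝ≥0∞} {A : Set X} {B : Set Y} (hA : IsFrostman t A)
    (hB : IsFrostman u B) : IsFrostman (t * u) (A ×ˢ B) := by
  obtain ⟨c, C, hc, hC, hA⟩ := hA.exists_isCompact
  obtain ⟨d, D, hd, hD, hB⟩ := hB
  refine ⟨c * d, C * D, mul_ne_zero hc hd, ENNReal.mul_ne_top hC hD, fun V hV hABV => ?_⟩
  have slice : ∀ y : B, ∃ μ : Measure X, ∃ F : Set X, ∃ O : Set Y, IsOpen O ∧ (y : Y) ∈ O ∧
      F ×ˢ O ⊆ V ∧ μ Fᶜ = 0 ∧ c ≤ μ univ ∧ μ univ ≤ C ∧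
      ∀ (n : ℕ) x, μ (Metric.closedBall x (2⁻¹ ^ n)) ≤ C * t ^ n := by
    rintro ⟨y, hy⟩
    obtain ⟨μ, F, hFV, hF, h⟩ := hA {x | (x, y) ∈ V} (hV.preimage (by fun_prop))
      (fun x hx => hABV ⟨hx, hy⟩)
    obtain ⟨P, O, -, hO, hFP, hyO, hPO⟩ := generalized_tube_lemma hF (isCompact_singleton (x := y))
      hV (by rintro ⟨x, z⟩ ⟨hx, rfl⟩; exact hFV hx)
    exact ⟨μ, F, O, hO, hyO rfl, (prod_mono_left hFP).trans hPO, h⟩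
  choose μ F O hO hyO hFO hF0 hμc hμC hμ using slice
  obtain ⟨ν, hν0, hνd, hνD, hν⟩ := hB (⋃ y, O y) (isOpen_iUnion hO)
    (fun y hy => mem_iUnion.2 ⟨⟨y, hy⟩, hyO _⟩)
  have : IsFiniteMeasure ν := ⟨hνD.trans_lt hD.lt_top⟩
  have : ∀ y, IsFiniteMeasure (μ y) := fun y => ⟨(hμC y).trans_lt hC.lt_top⟩
  obtain ⟨T, hT, hTO⟩ := TopologicalSpace.isOpen_iUnion_countable O hO
  rw [← hTO] at hν0
  have hTne : T.Nonempty := by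
    rw [nonempty_iff_ne_empty]
    rintro rfl
    simp only [mem_empty_iff_false, iUnion_of_empty, iUnion_empty, compl_empty] at hν0
    exact hd (le_zero_iff.1 (hνd.trans_eq hν0))
  obtain ⟨f, rfl⟩ := hT.exists_eq_range hTne
  rw [biUnion_range] at hν0
  set P : ℕ → Set Y := disjointed fun i => O (f i)
  have hPm : ∀ i, MeasurableSet (P i) := 
    fun i => MeasurableSet.disjointed (fun i => (hO (f i)).measurableSet) i
  have hPsum : ∀ E, MeasurableSet E → ∑' i, ν.restrict (P i) E = ν E := by
    intro E hE
    rw [← Measure.sum_apply _ hE, ← Measure.restrict_iUnion (disjoint_disjointed _) hPm,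
      iUnion_disjointed, Measure.restrict_apply hE]
    refine le_antisymm (measure_mono inter_subset_left) ?_
    refine (measure_le_inter_add_sdiff ν E (⋃ i, O (f i))).trans ?_
    rw [measure_mono_null (s := E \ ⋃ i, O (f i)) (fun x hx => hx.2) hν0, add_zero]
  refine ⟨Measure.sum fun i => (μ (f i)).prod (ν.restrict (P i)), ?_, ?_, ?_, fun n x => ?_⟩
  · rw [Measure.sum_apply _ hV.measurableSet.compl, ENNReal.tsum_eq_zero]
    intro i
    have hsub : Vᶜ ⊆ (F (f i))ᶜ ×ˢ univ ∪ univ ×ˢ (P i)ᶜ := by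
      rintro ⟨x, y⟩ hxy
      by_contra! H
      simp only [mem_union, mem_prod, mem_compl_iff, mem_univ, and_true, true_and, not_or,
        not_not] at H
      exact hxy (hFO _ ⟨H.1, disjointed_subset (fun i => O (f i)) i H.2⟩)
    refine measure_mono_null hsub (measure_union_null ?_ ?_)
    · rw [Measure.prod_prod, hF0, zero_mul]
    · rw [Measure.prod_prod, Measure.restrict_apply (hPm i).compl, compl_inter_self, measure_empty,
        mul_zero]
  · rw [Measure.sum_apply _ MeasurableSet.univ]
    calc c * d ≤ c * ν univ := by gcongr
      _ = ∑' i, c * ν.restrict (P i) univ := by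
        rw [ENNReal.tsum_mul_left, hPsum _ MeasurableSet.univ]
      _ ≤ _ := ENNReal.tsum_le_tsum fun i => by
        rw [← univ_prod_univ, Measure.prod_prod]; gcongr; exact hμc _
  · rw [Measure.sum_apply _ MeasurableSet.univ]
    calc _ ≤ ∑' i, C * ν.restrict (P i) univ := ENNReal.tsum_le_tsum fun i => by
          rw [← univ_prod_univ, Measure.prod_prod]; gcongr; exact hμC _
      _ = C * ν univ := by rw [ENNReal.tsum_mul_left, hPsum _ MeasurableSet.univ]
      _ ≤ C * D := by gcongr
  · rw [← closedBall_prod_same, Measure.sum_apply _ 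
      (measurableSet_closedBall.prod measurableSet_closedBall)]
    calc _ ≤ ∑' i, C * t ^ n * ν.restrict (P i) (Metric.closedBall x.2 (2⁻¹ ^ n)) :=
          ENNReal.tsum_le_tsum fun i => by
            rw [Measure.prod_prod]; gcongr; exact hμ _ _ _
      _ = C * t ^ n * ν (Metric.closedBall x.2 (2⁻¹ ^ n)) := by
          rw [ENNReal.tsum_mul_left, hPsum _ measurableSet_closedBall]
      _ ≤ C * t ^ n * (D * u ^ n) := by gcongr; exact hν _ _
      _ = C * D * (t * u) ^ n := by ring

theorem IsFrostman.of_isometryEquiv {X Y : Type*} [MetricSpace X] [MeasurableSpace X]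
    [BorelSpace X] [MetricSpace Y] [MeasurableSpace Y] [BorelSpace Y] {t : ℝ≥0∞} {A : Set X}
    (hA : IsFrostman t A) (e : X ≃ᵢ Y) : IsFrostman t (e '' A) := by
  obtain ⟨c, C, hc, hC, hA⟩ := hA
  refine ⟨c, C, hc, hC, fun V hV hAV => ?_⟩
  obtain ⟨μ, hμ0, hμc, hμC, hμ⟩ := hA (e ⁻¹' V) (hV.preimage e.continuous) (image_subset_iff.1 hAV)
  have he : Measurable e := e.continuous.measurable
  refine ⟨μ.map e, ?_, ?_, ?_, fun n x => ?_⟩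
  · rwa [Measure.map_apply he hV.measurableSet.compl]
  · rwa [Measure.map_apply he MeasurableSet.univ]
  · rwa [Measure.map_apply he MeasurableSet.univ]
  · rw [Measure.map_apply he measurableSet_closedBall, IsometryEquiv.preimage_closedBall]
    exact hμ _ _

/-- The coordinate splitting of `Fin (n + 1) → ℝ` as an isometry. -/
def finConsIsometryEquiv (n : ℕ) : ℝ × (Fin n → ℝ) ≃ᵢ (Fin (n + 1) → ℝ) where
  toEquiv := Fin.consEquiv fun _ => ℝ
  isometry_toFun := Isometry.of_dist_eq fun x y => by
    refine le_antisymm ((dist_pi_le_iff dist_nonneg).2 fun i => ?_) ?_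
    · refine Fin.cases ?_ (fun i => ?_) i
      · exact le_max_left _ _
      · exact (dist_le_pi_dist x.2 y.2 i).trans (le_max_right _ _)
    · refine max_le ?_ ((dist_pi_le_iff dist_nonneg).2 fun i => ?_)
      · exact dist_le_pi_dist (Fin.consEquiv (fun _ => ℝ) x) (Fin.consEquiv (fun _ => ℝ) y) 0
      · exact dist_le_pi_dist (Fin.consEquiv (fun _ => ℝ) x) (Fin.consEquiv (fun _ => ℝ) y) i.succ

theorem IsFrostman.pi {t : ℝ≥0∞} {K : Set ℝ} (hK : IsFrostman t K) (n : ℕ) :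
    IsFrostman (t ^ n) {x : Fin n → ℝ | ∀ i, x i ∈ K} := by
  induction n with
  | zero =>
    refine ⟨1, 1, by simp, by simp, fun V hV hKV => ⟨Measure.dirac 0, ?_, by simp, by simp, ?_⟩⟩
    · have : V = univ := eq_univ_of_forall fun x => hKV fun i => i.elim0
      simp [this]
    · intro n x; simpa using prob_le_one (μ := Measure.dirac (0 : Fin 0 → ℝ))
  | succ n ih =>
    have himg : {x : Fin (n + 1) → ℝ | ∀ i, x i ∈ K} =
        finConsIsometryEquiv n '' (K ×ˢ {x : Fin n → ℝ | ∀ i, x i ∈ K}) := by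
      refine Subset.antisymm (fun x hx => ?_) ?_
      · exact ⟨(x 0, fun i => x i.succ), ⟨hx 0, fun i => hx i.succ⟩, Fin.cons_self_tail x⟩
      · rintro _ ⟨y, hy, rfl⟩ i
        exact Fin.cases hy.1 hy.2 i
    rw [pow_succ', himg]
    exact (hK.prod ih).of_isometryEquiv (finConsIsometryEquiv n)

theorem volume_slab_mul_norm_le {n : ℕ} (d : Fin (n + 1) → ℝ) {η : ℝ} :
    volume {a : Fin (n + 1) → ℝ | a ∈ Icc 0 1 ∧ |∑ i, a i * d i| < η} * ENNReal.ofReal ‖d‖ ≤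
      ENNReal.ofReal (2 * η) := by
  rcases eq_or_ne d 0 with rfl | hd
  · simp
  obtain ⟨i, -, hi⟩ := Finset.exists_mem_eq_sup Finset.univ Finset.univ_nonempty fun i => ‖d i‖₊
  have hdi : ‖d‖ = |d i| := by rw [Pi.norm_def, hi]; rfl
  have hpos : 0 < |d i| := by rw [← hdi]; exact norm_pos_iff.2 hd
  set T : Set (ℝ × (Fin n → ℝ)) :=
    {p | p.2 ∈ Icc 0 1 ∧ |p.1 * d i + ∑ j, p.2 j * d (i.succAbove j)| < η} with hT
  have hTm : MeasurableSet T := by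
    refine (measurableSet_Icc.preimage measurable_snd).inter ?_
    have hc : Continuous fun p : ℝ × (Fin n → ℝ) =>
        |p.1 * d i + ∑ j, p.2 j * d (i.succAbove j)| := by fun_prop
    exact (isOpen_lt hc continuous_const).measurableSet
  have hsub : {a : Fin (n + 1) → ℝ | a ∈ Icc 0 1 ∧ |∑ i, a i * d i| < η} ⊆
      MeasurableEquiv.piFinSuccAbove (fun _ => ℝ) i ⁻¹' T := by
    rintro a ⟨ha, ha'⟩
    refine ⟨⟨fun j => ha.1 _, fun j => ha.2 _⟩, ?_⟩
    rwa [Fin.sum_univ_succAbove _ i] at ha'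
  have hline : ∀ c : ℝ, volume {z : ℝ | |z * d i + c| < η} ≤ ENNReal.ofReal (2 * (η / |d i|)) := by
    intro c
    rw [← Real.volume_ball (-c / d i)]
    refine measure_mono fun z hz => ?_
    rw [Metric.mem_ball, Real.dist_eq, lt_div_iff₀ hpos, ← abs_mul]
    have : (z - -c / d i) * d i = z * d i + c := by
      field_simp [abs_pos.1 hpos]
      ring
    rw [this]; exact hz
  have hvol : volume T ≤ ENNReal.ofReal (2 * (η / |d i|)) := by
    rw [Measure.volume_eq_prod, Measure.prod_apply_symm hTm]
    calc _ ≤ ∫⁻ b : Fin n → ℝ, (Icc 0 1).indicator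
            (fun _ => ENNReal.ofReal (2 * (η / |d i|))) b := by
          refine lintegral_mono fun b => ?_
          by_cases hb : b ∈ Icc (0 : Fin n → ℝ) 1
          · rw [indicator_of_mem hb]
            exact (measure_mono fun z hz => hz.2).trans (hline (∑ j, b j * d (i.succAbove j)))
          · have : (fun x : ℝ => (x, b)) ⁻¹' T = ∅ :=
              eq_empty_of_forall_notMem fun z hz => hb hz.1
            simp [this]
      _ = _ := by
          rw [lintegral_indicator_const measurableSet_Icc, Real.volume_Icc_pi]
          simp
  calc _ ≤ ENNReal.ofReal (2 * (η / |d i|)) * ENNReal.ofReal ‖d‖ := by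
        gcongr
        refine (measure_mono hsub).trans ?_
        rw [(volume_preserving_piFinSuccAbove (fun _ => ℝ) i).measure_preimage
          hTm.nullMeasurableSet]
        exact hvol
    _ = ENNReal.ofReal (2 * η) := by
        rw [hdi, ← ENNReal.ofReal_mul' hpos.le, mul_assoc, div_mul_cancel₀ _ hpos.ne']

theorem volume_slab_le {n : ℕ} (x y : Fin (n + 1) → ℝ) {η : ℝ} :
    volume {a : Fin (n + 1) → ℝ | a ∈ Icc 0 1 ∧ |∑ i, a i * (y i - x i)| < η} ≤
      ENNReal.ofReal (2 * η) * (1 + ∑' m : ℕ, 2 ^ (m + 1) *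
        (Metric.closedBall x (2⁻¹ ^ m)).indicator 1 y) := by
  have key := volume_slab_mul_norm_le (y - x) (η := η)
  simp only [Pi.sub_apply] at key
  set v := volume {a : Fin (n + 1) → ℝ | a ∈ Icc 0 1 ∧ |∑ i, a i * (y i - x i)| < η}
  rcases lt_or_ge 1 ‖y - x‖ with h | h
  · calc v ≤ v * ENNReal.ofReal ‖y - x‖ := by
          exact le_mul_of_one_le_right zero_le (ENNReal.one_le_ofReal.2 h.le)
      _ ≤ _ := key.trans (le_mul_of_one_le_right zero_le le_self_add)
  rcases (norm_nonneg (y - x)).eq_or_lt with h0 | h0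
  · have hxy : y = x := by rwa [eq_comm, norm_eq_zero, sub_eq_zero] at h0
    rcases le_or_gt η 0 with hη | hη
    · have : v = 0 := by
        have : {a : Fin (n + 1) → ℝ | a ∈ Icc 0 1 ∧ |∑ i, a i * (y i - x i)| < η} = ∅ :=
          eq_empty_of_forall_notMem fun a ha => (hη.trans (abs_nonneg _)).not_gt ha.2
        simp only [v, this, measure_empty]
      simp [this]
    · have : ∑' m : ℕ, (2 : ℝ≥0∞) ^ (m + 1) *
          (Metric.closedBall x (2⁻¹ ^ m)).indicator 1 y = ∞ := by
        rw [hxy, ← top_le_iff]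
        calc (∞ : ℝ≥0∞) = ∑' m : ℕ, (1 : ℝ≥0∞) := by
              rw [ENNReal.tsum_const_eq_top_of_ne_zero one_ne_zero]
          _ ≤ _ := ENNReal.tsum_le_tsum fun m => by
              rw [indicator_of_mem (Metric.mem_closedBall_self (by positivity)), Pi.one_apply,
                mul_one]
              exact one_le_pow₀ (by norm_num)
      rw [this, add_top, ENNReal.mul_top (by simpa using hη)]
      exact le_top
  · obtain ⟨m, hm, hm'⟩ := exists_nat_pow_near_of_lt_one h0 h
      (show (0 : ℝ) < 2⁻¹ by norm_num) (by norm_num)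
    have h1 : 1 ≤ ENNReal.ofReal ‖y - x‖ * 2 ^ (m + 1) := by
      have : (2 : ℝ≥0∞) ^ (m + 1) = ENNReal.ofReal (2 ^ (m + 1)) := by
        rw [ENNReal.ofReal_pow (by norm_num)]; simp
      rw [this, ← ENNReal.ofReal_mul (norm_nonneg _), ENNReal.one_le_ofReal,
        ← div_le_iff₀ (by positivity), one_div, ← inv_pow]
      exact hm.le
    have hy : y ∈ Metric.closedBall x (2⁻¹ ^ m) := by
      rwa [Metric.mem_closedBall, dist_eq_norm]
    calc v ≤ v * (ENNReal.ofReal ‖y - x‖ * 2 ^ (m + 1)) := le_mul_of_one_le_right zero_le h1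
      _ ≤ ENNReal.ofReal (2 * η) * 2 ^ (m + 1) := by rw [← mul_assoc]; gcongr
      _ ≤ _ := by
        gcongr
        refine le_trans ?_ le_add_self
        refine le_trans ?_ (ENNReal.le_tsum m)
        rw [indicator_of_mem hy, Pi.one_apply, mul_one]

theorem lintegral_slab_le {n : ℕ} {μ : Measure (Fin (n + 1) → ℝ)} {C u : ℝ≥0∞}
    (hC : μ univ ≤ C) (hμ : ∀ (m : ℕ) x, μ (Metric.closedBall x (2⁻¹ ^ m)) ≤ C * u ^ m)
    (x : Fin (n + 1) → ℝ) (η : ℝ) :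
    ∫⁻ y, volume {a : Fin (n + 1) → ℝ | a ∈ Icc 0 1 ∧ |∑ i, a i * (y i - x i)| < η} ∂μ ≤
      ENNReal.ofReal (2 * η) * (C * (1 + 2 * (1 - 2 * u)⁻¹)) := by
  have hm : ∀ m : ℕ, Measurable fun y => (2 : ℝ≥0∞) ^ (m + 1) *
      (Metric.closedBall x (2⁻¹ ^ m)).indicator (1 : (Fin (n + 1) → ℝ) → ℝ≥0∞) y := fun m =>
    (measurable_one.indicator measurableSet_closedBall).const_mul _
  refine (lintegral_mono fun y => volume_slab_le x y).trans ?_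
  have hsum : Measurable fun y => 1 + ∑' m : ℕ, (2 : ℝ≥0∞) ^ (m + 1) *
      (Metric.closedBall x (2⁻¹ ^ m)).indicator (1 : (Fin (n + 1) → ℝ) → ℝ≥0∞) y :=
    measurable_const.add (Measurable.tsum hm)
  rw [lintegral_const_mul _ hsum]
  gcongr
  rw [lintegral_add_left measurable_const, lintegral_const, one_mul,
    lintegral_tsum fun m => (hm m).aemeasurable, mul_add, mul_one]
  gcongr
  calc _ ≤ ∑' m : ℕ, C * 2 * (2 * u) ^ m := ENNReal.tsum_le_tsum fun m => by
        rw [lintegral_const_mul _ (measurable_one.indicator measurableSet_closedBall),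
          lintegral_indicator_one measurableSet_closedBall]
        calc _ ≤ 2 ^ (m + 1) * (C * u ^ m) := by gcongr; exact hμ m x
          _ = _ := by ring
    _ = _ := by rw [ENNReal.tsum_mul_left, ENNReal.tsum_geometric, mul_assoc]

/-- The square of the mass that `μ` gives to `δ`-slabs, integrated over the unit cube. -/
theorem lintegral_sq_slab_le {n : ℕ} {μ : Measure (Fin (n + 1) → ℝ)} [IsFiniteMeasure μ]
    {C u : ℝ≥0∞} (hC : μ univ ≤ C)
    (hμ : ∀ (m : ℕ) x, μ (Metric.closedBall x (2⁻¹ ^ m)) ≤ C * u ^ m) (δ : ℝ) :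
    ∫⁻ p : (Fin (n + 1) → ℝ) × ℝ, μ {x | |p.2 - ∑ i, p.1 i * x i| < δ} * μ {x | |p.2 - ∑ i, p.1 i * x i| < δ}
        ∂((volume.restrict (Icc 0 1)).prod volume) ≤
      ENNReal.ofReal (2 * δ) * (ENNReal.ofReal (2 * (2 * δ)) *
        (C * (1 + 2 * (1 - 2 * u)⁻¹)) * C) := by
  set lam : Measure ((Fin (n + 1) → ℝ) × ℝ) := (volume.restrict (Icc 0 1)).prod volume with hlam
  set G : Set (((Fin (n + 1) → ℝ) × ℝ) × ((Fin (n + 1) → ℝ) × (Fin (n + 1) → ℝ))) :=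
    {q | |q.1.2 - ∑ i, q.1.1 i * q.2.1 i| < δ ∧ |q.1.2 - ∑ i, q.1.1 i * q.2.2 i| < δ} with hG
  have hGm : MeasurableSet G := by
    have h1 : Continuous fun q : ((Fin (n + 1) → ℝ) × ℝ) × ((Fin (n + 1) → ℝ) × (Fin (n + 1) → ℝ)) =>
      |q.1.2 - ∑ i, q.1.1 i * q.2.1 i| := by fun_prop
    have h2 : Continuous fun q : ((Fin (n + 1) → ℝ) × ℝ) × ((Fin (n + 1) → ℝ) × (Fin (n + 1) → ℝ)) =>
      |q.1.2 - ∑ i, q.1.1 i * q.2.2 i| := by fun_prop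
    exact ((isOpen_lt h1 continuous_const).inter (isOpen_lt h2 continuous_const)).measurableSet
  have hslice : ∀ z : (Fin (n + 1) → ℝ) × (Fin (n + 1) → ℝ),
      lam ((fun p => (p, z)) ⁻¹' G) ≤ ENNReal.ofReal (2 * δ) *
        volume {a : Fin (n + 1) → ℝ | a ∈ Icc 0 1 ∧ |∑ i, a i * (z.2 i - z.1 i)| < 2 * δ} := by
    rintro ⟨x, y⟩
    have hS : MeasurableSet {a : Fin (n + 1) → ℝ | |∑ i, a i * (y i - x i)| < 2 * δ} := by
      have : Continuous fun a : Fin (n + 1) → ℝ => |∑ i, a i * (y i - x i)| := by fun_prop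
      exact (isOpen_lt this continuous_const).measurableSet
    rw [hlam, Measure.prod_apply (hGm.preimage (by fun_prop))]
    calc _ ≤ ∫⁻ a in Icc (0 : Fin (n + 1) → ℝ) 1,
            {a : Fin (n + 1) → ℝ | |∑ i, a i * (y i - x i)| < 2 * δ}.indicator
              (fun _ => ENNReal.ofReal (2 * δ)) a := by
          refine lintegral_mono fun a => ?_
          by_cases ha : |∑ i, a i * (y i - x i)| < 2 * δ
          · rw [indicator_of_mem (by exact ha), ← Real.volume_ball (∑ i, a i * x i)]
            exact measure_mono fun z hz => hz.1
          · rw [indicator_of_notMem (by exact ha), le_zero_iff]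
            convert measure_empty (μ := volume)
            refine eq_empty_of_forall_notMem fun z hz => ha ?_
            have h1 : |z - ∑ i, a i * x i| < δ := hz.1
            have h2 : |z - ∑ i, a i * y i| < δ := hz.2
            simp only [mul_sub, Finset.sum_sub_distrib]
            rw [abs_lt] at *
            constructor <;> linarith
      _ = _ := by
          rw [lintegral_indicator_const hS, Measure.restrict_apply hS, inter_comm]
          rfl
  calc _ = ∫⁻ p, (μ.prod μ) (Prod.mk p ⁻¹' G) ∂lam := by
        refine lintegral_congr fun p => ?_
        rw [← Measure.prod_prod]
        rfl
    _ = ∫⁻ z, lam ((fun p => (p, z)) ⁻¹' G) ∂(μ.prod μ) := by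
        rw [← Measure.prod_apply hGm, Measure.prod_apply_symm hGm]
    _ ≤ ∫⁻ z, ENNReal.ofReal (2 * δ) * volume {a : Fin (n + 1) → ℝ | a ∈ Icc 0 1 ∧
          |∑ i, a i * (z.2 i - z.1 i)| < 2 * δ} ∂(μ.prod μ) := lintegral_mono hslice
    _ = ENNReal.ofReal (2 * δ) * ∫⁻ z, volume {a : Fin (n + 1) → ℝ | a ∈ Icc 0 1 ∧
          |∑ i, a i * (z.2 i - z.1 i)| < 2 * δ} ∂(μ.prod μ) :=
        lintegral_const_mul' _ _ ENNReal.ofReal_ne_top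
    _ ≤ ENNReal.ofReal (2 * δ) * ∫⁻ x, ∫⁻ y, volume {a : Fin (n + 1) → ℝ | a ∈ Icc 0 1 ∧
          |∑ i, a i * (y i - x i)| < 2 * δ} ∂μ ∂μ := by
        gcongr
        exact lintegral_prod_le _
    _ ≤ ENNReal.ofReal (2 * δ) * ∫⁻ _x, ENNReal.ofReal (2 * (2 * δ)) *
          (C * (1 + 2 * (1 - 2 * u)⁻¹)) ∂μ := by
        gcongr with x
        exact lintegral_slab_le hC hμ x _
    _ ≤ _ := by
        rw [lintegral_const]
        gcongr

theorem lintegral_slab_eq {n : ℕ} {μ : Measure (Fin (n + 1) → ℝ)} [IsFiniteMeasure μ] (δ : ℝ) :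
    ∫⁻ p : (Fin (n + 1) → ℝ) × ℝ, μ {x | |p.2 - ∑ i, p.1 i * x i| < δ} ∂((volume.restrict (Icc 0 1)).prod volume) =
      ENNReal.ofReal (2 * δ) * μ univ := by
  set G : Set (((Fin (n + 1) → ℝ) × ℝ) × (Fin (n + 1) → ℝ)) :=
    {q | |q.1.2 - ∑ i, q.1.1 i * q.2 i| < δ} with hG
  have hGm : MeasurableSet G := by
    have h1 : Continuous fun q : ((Fin (n + 1) → ℝ) × ℝ) × (Fin (n + 1) → ℝ) =>
      |q.1.2 - ∑ i, q.1.1 i * q.2 i| := by fun_prop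
    exact (isOpen_lt h1 continuous_const).measurableSet
  calc _ = ∫⁻ x, ((volume.restrict (Icc 0 1)).prod volume) ((fun p => (p, x)) ⁻¹' G) ∂μ := by
        rw [← Measure.prod_apply_symm hGm, Measure.prod_apply hGm]; rfl
    _ = ∫⁻ _x, ENNReal.ofReal (2 * δ) ∂μ := by
        refine lintegral_congr fun x => ?_
        rw [Measure.prod_apply (hGm.preimage (by fun_prop))]
        calc _ = ∫⁻ _a in Icc (0 : Fin (n + 1) → ℝ) 1, ENNReal.ofReal (2 * δ) := by
              refine lintegral_congr fun a => ?_
              rw [← Real.volume_ball (∑ i, a i * x i)]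
              rfl
          _ = _ := by simp [Real.volume_Icc_pi]
    _ = _ := by rw [lintegral_const]

/-- If a measure with small energy lives on points whose `δ`-slabs over the unit cube lie in `U`,
then `U` cannot be small. -/
theorem mass_le_of_slab_subset {n : ℕ} {μ : Measure (Fin (n + 1) → ℝ)} [IsFiniteMeasure μ]
    {C u : ℝ≥0∞} (hC : μ univ ≤ C)
    (hμ : ∀ (m : ℕ) x, μ (Metric.closedBall x (2⁻¹ ^ m)) ≤ C * u ^ m) {δ : ℝ} (hδ : 0 < δ)
    {F : Set (Fin (n + 1) → ℝ)} (hF : μ Fᶜ = 0) {U : Set ((Fin (n + 1) → ℝ) × ℝ)}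
    (hU : MeasurableSet U) (hFU : ∀ x ∈ F, ∀ a ∈ Icc (0 : Fin (n + 1) → ℝ) 1, ∀ y : ℝ,
      |y - ∑ i, a i * x i| < δ → (a, y) ∈ U) {N : ℝ≥0∞} (hN : N ≠ 0) (hN' : N ≠ ∞) :
    μ univ ≤ N * volume U + N⁻¹ * (2 * (C * (1 + 2 * (1 - 2 * u)⁻¹)) * C) := by
  set g : (Fin (n + 1) → ℝ) × ℝ → ℝ≥0∞ := fun p => μ {x | |p.2 - ∑ i, p.1 i * x i| < δ} with hg
  set lam : Measure ((Fin (n + 1) → ℝ) × ℝ) := (volume.restrict (Icc 0 1)).prod volume with hlam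
  set D := ENNReal.ofReal (2 * δ) with hD
  have hD0 : D ≠ 0 := by simpa [hD] using hδ
  have hDt : D ≠ ∞ := ENNReal.ofReal_ne_top
  have hlam' : lam = volume.restrict (Icc 0 1 ×ˢ univ) := by
    rw [Measure.volume_eq_prod, ← Measure.prod_restrict, Measure.restrict_univ]
  have hpt : ∀ p ∈ Icc (0 : Fin (n + 1) → ℝ) 1 ×ˢ (univ : Set ℝ),
      g p ≤ U.indicator (fun _ => N * D) p + (N * D)⁻¹ * (g p * g p) := by
    rintro ⟨a, y⟩ ⟨ha, -⟩
    by_cases hp : (a, y) ∈ U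
    · rw [indicator_of_mem hp]
      rcases le_total (g (a, y)) (N * D) with h | h
      · exact h.trans le_self_add
      · refine le_trans ?_ le_add_self
        calc g (a, y) = (N * D)⁻¹ * (N * D * g (a, y)) := by
              rw [← mul_assoc, ENNReal.inv_mul_cancel (mul_ne_zero hN hD0)
                (ENNReal.mul_ne_top hN' hDt), one_mul]
          _ ≤ _ := by gcongr
    · have : g (a, y) = 0 :=
        measure_mono_null (fun x hx hxF => hp (hFU x hxF a ha y hx)) hF
      simp [this]
  have hsq := lintegral_sq_slab_le hC hμ δ
  have heq := lintegral_slab_eq (μ := μ) δ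
  rw [← hlam, ← hD] at hsq heq
  have hmul : D * μ univ ≤ D * (N * volume U + N⁻¹ * (2 * (C * (1 + 2 * (1 - 2 * u)⁻¹)) * C)) := by
    calc D * μ univ = ∫⁻ p, g p ∂lam := heq.symm
      _ ≤ ∫⁻ p, U.indicator (fun _ => N * D) p + (N * D)⁻¹ * (g p * g p) ∂lam := by
          rw [hlam']
          exact setLIntegral_mono' (measurableSet_Icc.prod MeasurableSet.univ) hpt
      _ = N * D * lam U + (N * D)⁻¹ * ∫⁻ p, g p * g p ∂lam := by
          rw [lintegral_add_left (measurable_const.indicator hU), lintegral_indicator_const hU,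
            lintegral_const_mul' _ _ (ENNReal.inv_ne_top.2 (mul_ne_zero hN hD0))]
      _ ≤ N * D * volume U + (N * D)⁻¹ * (D * (2 * D *
            (C * (1 + 2 * (1 - 2 * u)⁻¹)) * C)) := by
          gcongr
          · rw [hlam']; exact Measure.restrict_le_self
          · refine hsq.trans_eq ?_
            rw [ENNReal.ofReal_mul (by norm_num : (0 : ℝ) ≤ 2), ← hD]
            simp
      _ = D * (N * volume U) + N⁻¹ * (D⁻¹ * D) * (D * (2 *
            (C * (1 + 2 * (1 - 2 * u)⁻¹)) * C)) := by
          rw [ENNReal.mul_inv (Or.inl hN) (Or.inl hN')]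
          ring
      _ = _ := by
          rw [ENNReal.inv_mul_cancel hD0 hDt]
          ring
  exact (ENNReal.mul_le_mul_iff_right hD0 hDt).1 hmul

/-- The graph over the unit cube of all linear forms with coefficients in a Frostman set of
dimension larger than one is not Lebesgue null. -/
theorem IsFrostman.volume_ne_zero {n : ℕ} {u : ℝ≥0∞} {L : Set (Fin (n + 1) → ℝ)}
    (hL : IsFrostman u L) (hu : 2 * u < 1) :
    volume {p : (Fin (n + 1) → ℝ) × ℝ | p.1 ∈ Icc 0 1 ∧ ∃ x ∈ L, p.2 = ∑ i, p.1 i * x i} ≠ 0 := by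
  obtain ⟨c, C, hc, hC, hL⟩ := hL.exists_isCompact
  intro hZ
  obtain ⟨_, _, _, _, _, h1, h2, _⟩ := hL univ isOpen_univ (subset_univ _)
  have hcC := h1.trans h2
  have hct : c ≠ ∞ := ne_top_of_le_ne_top hC hcC
  set Q := 2 * (C * (1 + 2 * (1 - 2 * u)⁻¹)) * C with hQ
  have hQt : Q ≠ ∞ := by
    have : (1 - 2 * u)⁻¹ ≠ ∞ := ENNReal.inv_ne_top.2 (tsub_pos_of_lt hu).ne'
    finiteness
  have hQ0 : Q ≠ 0 := by
    have : C ≠ 0 := fun h => hc (le_zero_iff.1 (hcC.trans_eq h))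
    simp [hQ, this]
  set N := 4 * Q / c with hN
  have hN0 : N ≠ 0 := by
    rw [hN]; exact (ENNReal.div_pos (mul_ne_zero (by norm_num) hQ0) hct).ne'
  have hNt : N ≠ ∞ := ENNReal.div_ne_top (by finiteness) hc
  obtain ⟨U, hZU, hU, hUlt⟩ := Set.exists_isOpen_lt_of_lt _ (c / 4 / N)
    (hZ.trans_lt (ENNReal.div_pos (ENNReal.div_pos hc (by norm_num)).ne' hNt))
  set f : (Fin (n + 1) → ℝ) × (Fin (n + 1) → ℝ) → (Fin (n + 1) → ℝ) × ℝ :=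
    fun q => (q.1, ∑ i, q.1 i * q.2 i) with hf
  have hfc : Continuous f := by fun_prop
  have hV : IsOpen {x | ∀ a ∈ Icc (0 : Fin (n + 1) → ℝ) 1, f (a, x) ∈ U} := by
    rw [isOpen_iff_mem_nhds]
    intro x hx
    obtain ⟨P, O, -, hO, hP, hxO, hPO⟩ := generalized_tube_lemma
      (isCompact_Icc (a := (0 : Fin (n + 1) → ℝ)) (b := 1)) (isCompact_singleton (x := x))
      (hU.preimage hfc) (by rintro ⟨a, z⟩ ⟨ha, rfl⟩; exact hx a ha)
    exact Filter.mem_of_superset (hO.mem_nhds (hxO rfl)) fun y hy a ha => hPO ⟨hP ha, hy⟩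
  obtain ⟨μ, F, hFV, hF, hF0, hμc, hμC, hμ⟩ := hL _ hV
    (fun x hx a ha => hZU ⟨ha, x, hx, rfl⟩)
  have : IsFiniteMeasure μ := ⟨hμC.trans_lt hC.lt_top⟩
  obtain ⟨δ, hδ, hδU⟩ := ((isCompact_Icc.prod hF).image hfc).exists_thickening_subset_open hU
    (by rintro _ ⟨⟨a, x⟩, ⟨ha, hx⟩, rfl⟩; exact hFV hx a ha)
  have hle := mass_le_of_slab_subset hμC hμ hδ hF0 hU.measurableSet (fun x hx a ha y hy => hδU
    (Metric.mem_thickening_iff.2 ⟨f (a, x), ⟨(a, x), ⟨ha, hx⟩, rfl⟩, by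
      rw [Prod.dist_eq, dist_self, max_eq_right dist_nonneg]; exact hy⟩)) hN0 hNt
  have hN1 : N⁻¹ * Q = c / 4 := by
    rw [hN, ENNReal.inv_div (Or.inl hct) (Or.inl hc), div_eq_mul_inv, ENNReal.mul_inv
      (Or.inl (by norm_num)) (Or.inl (by norm_num)), mul_assoc, mul_assoc,
      ENNReal.inv_mul_cancel hQ0 hQt, mul_one, div_eq_mul_inv]
  have hN2 : N * volume U ≤ c / 4 := by
    rw [mul_comm]; exact ENNReal.mul_le_of_le_div hUlt.le
  have : c ≤ c / 2 := by
    calc c ≤ c / 4 + c / 4 := (hμc.trans hle).trans (add_le_add hN2 hN1.le)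
      _ = (c / 2) / 2 + (c / 2) / 2 := by
        rw [show (4 : ℝ≥0∞) = 2 * 2 by norm_num]
        simp only [div_eq_mul_inv, ENNReal.mul_inv (Or.inl (two_ne_zero (α := ℝ≥0∞)))
          (Or.inl (ENNReal.ofNat_ne_top (n := 2))), mul_assoc]
      _ = c / 2 := ENNReal.add_halves _
  exact (ENNReal.half_lt_self hc hct).not_ge this

/-- Capacitability of analytic sets: a non-null analytic set contains a non-null compact set. -/
theorem MeasureTheory.AnalyticSet.exists_isCompact_measure_ne_zero {X : Type*} [TopologicalSpace X]
    [MeasurableSpace X] {μ : Measure X} [μ.OuterRegular] {Z : Set X} (hZ : AnalyticSet Z)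
    (hμ : μ Z ≠ 0) : ∃ Q ⊆ Z, IsCompact Q ∧ μ Q ≠ 0 := by
  rw [AnalyticSet] at hZ
  obtain rfl | ⟨f, hf, rfl⟩ := hZ
  · simp at hμ
  obtain ⟨c, hc, hcZ⟩ := exists_between (pos_iff_ne_zero.2 hμ)
  have step : ∀ (B : Set (ℕ → ℕ)) (k : ℕ), c < μ (f '' B) →
      ∃ m, c < μ (f '' (B ∩ {x | x k ≤ m})) := by
    intro B k hB
    have hmono : Monotone fun m => f '' (B ∩ {x | x k ≤ m}) := fun m m' h =>
      image_mono (inter_subset_inter_right _ fun x (hx : x k ≤ m) => hx.trans h)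
    have hU : ⋃ m, f '' (B ∩ {x | x k ≤ m}) = f '' B := by
      rw [← image_iUnion, ← inter_iUnion, (iUnion_eq_univ_iff.2 fun x => ⟨x k, le_refl (x k)⟩ :
        ⋃ m, {x : ℕ → ℕ | x k ≤ m} = univ), inter_univ]
    rw [← hU, hmono.measure_iUnion] at hB
    exact lt_iSup_iff.1 hB
  choose! g hg using step
  let B : ℕ → Set (ℕ → ℕ) := fun k =>
    Nat.rec univ (fun k B => B ∩ {x | x k ≤ g B k}) k
  have hBs : ∀ k, B (k + 1) = B k ∩ {x | x k ≤ g (B k) k} := fun k => rfl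
  have hB : ∀ k, c < μ (f '' B k) := by
    intro k
    induction k with
    | zero => simpa [B] using hcZ
    | succ k ih => rw [hBs]; exact hg _ _ ih
  set m : ℕ → ℕ := fun k => g (B k) k with hm
  have hBm : ∀ k, ∀ x ∈ B k, ∀ i < k, x i ≤ m i := by
    intro k
    induction k with
    | zero => simp
    | succ k ih =>
      intro x hx i hi
      rw [hBs] at hx
      rcases Nat.lt_succ_iff_lt_or_eq.1 hi with h | rfl
      · exact ih x hx.1 i h
      · exact hx.2
  set A : Set (ℕ → ℕ) := univ.pi fun i => Iic (m i) with hA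
  have hAc : IsCompact A := isCompact_univ_pi fun i => (finite_Iic (m i)).isCompact
  refine ⟨f '' A, image_subset_range _ _, hAc.image hf, fun h0 => ?_⟩
  obtain ⟨U, hAU, hU, hUc⟩ := (f '' A).exists_isOpen_lt_of_lt c (h0.trans_lt hc)
  have hnot : ∀ k, ∃ x ∈ B k, f x ∉ U := by
    intro k
    by_contra h
    push Not at h
    exact ((hB k).trans_le (measure_mono (image_subset_iff.2 h))).not_gt hUc
  choose x hxB hxU using hnot
  obtain ⟨a, ha, φ, hφ, hlim⟩ := hAc.tendsto_subseq (x := fun k i => min (x k i) (m i))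
    fun k i _ => min_le_right (x k i) (m i)
  have hlim' : Filter.Tendsto (x ∘ φ) Filter.atTop (nhds a) := by
    rw [tendsto_pi_nhds] at hlim ⊢
    refine fun i => (hlim i).congr' ?_
    filter_upwards [Filter.eventually_gt_atTop i] with k hk
    exact min_eq_left (hBm _ _ (hxB _) i (hk.trans_le (hφ.id_le k)))
  have hmem := (hf.tendsto a).comp hlim' |>.eventually (hU.mem_nhds (hAU ⟨a, ha, rfl⟩))
  obtain ⟨k, hk⟩ := hmem.exists
  exact hxU _ hk

/-- An additive subgroup of `ℝ` containing a non-null measurable set is everything. -/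
theorem AddSubgroup.eq_top_of_volume_ne_zero (T : AddSubgroup ℝ) {E : Set ℝ}
    (hE : MeasurableSet E) (hE0 : volume E ≠ 0) (hET : E ⊆ T) : T = ⊤ := by
  have hnhds : (T : Set ℝ) ∈ nhds 0 := by
    refine Filter.mem_of_superset
      (Measure.sub_mem_nhds_zero_of_addHaar_pos volume E hE (pos_iff_ne_zero.2 hE0)) ?_
    rintro _ ⟨x, hx, y, hy, rfl⟩
    exact T.sub_mem (hET hx) (hET hy)
  refine (AddSubgroup.eq_top_iff' T).2 fun y => ?_
  have hlim : Filter.Tendsto (fun N : ℕ => y / (N : ℝ)) Filter.atTop (nhds 0) :=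
    tendsto_const_div_atTop_nhds_zero_nat y
  obtain ⟨N, hN, hN0⟩ := ((hlim.eventually hnhds).and (Filter.eventually_gt_atTop 0)).exists
  have := T.nsmul_mem hN N
  rwa [nsmul_eq_mul, mul_div_cancel₀ _ (by positivity)] at this

/-- A Borel subring of `ℝ` over which `ℝ` is a finite module is all of `ℝ`. -/
theorem Subring.eq_top_of_measurableSet_of_finite (R : Subring ℝ) (hR : MeasurableSet (R : Set ℝ))
    [Module.Finite R ℝ] : R = ⊤ := by
  have hint : Algebra.IsIntegral R ℝ := Algebra.IsIntegral.of_finite R ℝ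
  have hfield : IsField R := isField_of_isIntegral_of_isField
    (FaithfulSMul.algebraMap_injective R ℝ) (Field.toIsField ℝ)
  let _ := hfield.toField
  let b := Module.finBasis R ℝ
  have : StandardBorelSpace R := hR.standardBorel
  obtain ⟨i⟩ := b.index_nonempty
  have he : Measurable b.equivFun.symm := by
    have : (b.equivFun.symm : (Fin _ → R) → ℝ) = fun x => ∑ i, (x i : ℝ) * b i := by
      funext x
      rw [Module.Basis.equivFun_symm_apply]
      rfl
    rw [this]
    fun_prop
  have hcoord : Measurable fun x : ℝ => b.equivFun x i := by
    have hemb := he.measurableEmbedding b.equivFun.symm.injective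
    have : Measurable (b.equivFun : ℝ → _) := by
      intro s hs
      have := hemb.measurableSet_image' hs
      rwa [LinearEquiv.image_symm_eq_preimage] at this
    exact (measurable_pi_apply i).comp this
  let π : ℝ →+ ℝ := R.subtype.toAddMonoidHom.comp
    ((LinearMap.proj i).comp b.equivFun.toLinearMap).toAddMonoidHom
  have hπ : ∀ x, π x = b.equivFun x i := fun x => rfl
  have hπm : Measurable π := measurable_subtype_coe.comp hcoord
  have hπc : Continuous π := MeasureTheory.Measure.AddMonoidHom.continuous_of_measurable π hπm
  have hlin : ∀ x, π x = x * π 1 := fun x => by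
    simpa using map_real_smul π hπc x 1
  have h1 : π (b i) = 1 := by simp [hπ]
  refine (Subring.eq_top_iff' R).2 fun y => ?_
  have : π (y * b i) = y := by rw [hlin, mul_assoc, ← hlin, h1, mul_one]
  rw [← this, hπ]
  exact Subtype.property _

theorem Subring.dimH_eq_zero_or_eq_top (R : Subring ℝ) (hR : MeasurableSet (R : Set ℝ)) :
    dimH (R : Set ℝ) = 0 ∨ R = ⊤ := by
  refine or_iff_not_imp_left.2 fun hdim => ?_
  obtain ⟨t, ht, j, hK⟩ := exists_isFrostman_of_dimH_ne_zero hdim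
  obtain ⟨n, hn⟩ : ∃ n, 2 * t ^ (n + 1) < 1 := by
    have h := (ENNReal.Tendsto.const_mul (ENNReal.tendsto_pow_atTop_nhds_zero_of_lt_one ht)
      (Or.inr (ENNReal.ofNat_ne_top (n := 2)))).comp (Filter.tendsto_add_atTop_nat 1)
    rw [mul_zero] at h
    exact (h.eventually (gt_mem_nhds one_pos)).exists
  have hvol := (hK.pi (n + 1)).volume_ne_zero hn
  set K := (R : Set ℝ) ∩ dyadicIco 0 j with hKdef
  have hKm : MeasurableSet K := hR.inter (measurableSet_dyadicIco _ _)
  set L := {x : Fin (n + 1) → ℝ | ∀ i, x i ∈ K} with hL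
  have hLm : MeasurableSet L := by
    have : L = univ.pi fun _ => K := by ext; simp [hL]
    rw [this]
    exact MeasurableSet.univ_pi fun _ => hKm
  have hZ : AnalyticSet {p : (Fin (n + 1) → ℝ) × ℝ |
      p.1 ∈ Icc 0 1 ∧ ∃ x ∈ L, p.2 = ∑ i, p.1 i * x i} := by
    have hf : Continuous fun q : (Fin (n + 1) → ℝ) × (Fin (n + 1) → ℝ) =>
        (q.1, ∑ i, q.1 i * q.2 i) := by fun_prop
    convert (measurableSet_Icc (a := (0 : Fin (n + 1) → ℝ)) (b := 1)|>.prod hLm).analyticSet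
      |>.image_of_continuous hf using 1
    ext ⟨a, y⟩
    constructor
    · rintro ⟨ha, x, hx, h⟩
      exact ⟨(a, x), ⟨ha, hx⟩, Prod.ext rfl h.symm⟩
    · rintro ⟨⟨a', x⟩, ⟨ha, hx⟩, h⟩
      obtain ⟨rfl, rfl⟩ := Prod.mk.inj h
      exact ⟨ha, x, hx, rfl⟩
  obtain ⟨Q, hQ, hQc, hQ0⟩ := hZ.exists_isCompact_measure_ne_zero hvol
  obtain ⟨a, ha⟩ : ∃ a, volume (Prod.mk a ⁻¹' Q) ≠ 0 := by
    by_contra! h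
    rw [Measure.volume_eq_prod, Measure.prod_apply hQc.measurableSet] at hQ0
    simp [h] at hQ0
  have hspan := AddSubgroup.eq_top_of_volume_ne_zero (Submodule.span R (range a)).toAddSubgroup
    (measurable_prodMk_left hQc.measurableSet) ha (by
      intro y hy
      obtain ⟨-, x, hx, h⟩ := hQ hy
      rw [show y = ∑ i, a i * x i from h]
      refine Submodule.sum_mem _ fun i _ => ?_
      rw [mul_comm]
      exact Submodule.smul_mem _ (⟨x i, (hx i).1⟩ : R) (Submodule.subset_span ⟨i, rfl⟩))
  have hfin : Module.Finite R ℝ := by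
    refine Module.finite_def.2 (Submodule.fg_def.2 ⟨range a, finite_range a, ?_⟩)
    exact Submodule.toAddSubgroup_injective hspan
  exact R.eq_top_of_measurableSet_of_finite hR

/-- **Edgar–Miller theorem**: a Borel subring of `ℝ` (a Borel set containing `0` and `1`,
closed under addition, negation and multiplication) either has Hausdorff dimension `0` or
is all of `ℝ`. -/
theorem edgar_miller (S : Set ℝ) (hBorel : MeasurableSet S)
    (h0 : (0 : ℝ) ∈ S) (h1 : (1 : ℝ) ∈ S)
    (hadd : ∀ x ∈ S, ∀ y ∈ S, x + y ∈ S)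
    (hneg : ∀ x ∈ S, -x ∈ S)
    (hmul : ∀ x ∈ S, ∀ y ∈ S, x * y ∈ S) :
    dimH S = 0 ∨ S = Set.univ := by
  let R : Subring ℝ :=
    { carrier := S
      mul_mem' := fun hx hy => hmul _ hx _ hy
      one_mem' := h1
      add_mem' := fun hx hy => hadd _ hx _ hy
      zero_mem' := h0
      neg_mem' := fun hx => hneg _ hx }
  exact (R.dimH_eq_zero_or_eq_top hBorel).imp id fun h =>
    congrArg (fun T : Subring ℝ => (T : Set ℝ)) h
end
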